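/- Let N ≥ 2 be a natural number and let ψ : ℝ^N → ℝ be continuously differentiable on the closed unit ball and twice continuously differentiable with Δψ = 0 on the open unit ball B₁. If ⟨∇ψ(x), x⟩ = ψ(x) for every x with ‖x‖ = 1 (i.e. ψ is a Steklov eigenfunction with eigenvalue 1), then there exists a vector a ∈ ℝ^N such that ψ(x) = ⟨a, x⟩ for all x in the closed unit ball. In particular, the kernel of the operator L(v) := (∂_ν ψ_v)|_{S^{N−1}} − v, where ψ_v is the harmonic extension of v to B₁, consists exactly of the restrictions to S^{N−1} of the linear coordinate functions x ↦ ⟨a, x⟩. -/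

import Mathlib

open scoped RealInnerProductSpace

/-- The Euclidean Laplacian: sum of second partial derivatives. -/
noncomputable def laplacian {N : ℕ} (f : EuclideanSpace ℝ (Fin N) → ℝ)
    (x : EuclideanSpace ℝ (Fin N)) : ℝ :=
  ∑ i : Fin N,
    fderiv ℝ (fun y => fderiv ℝ f y (EuclideanSpace.single i (1 : ℝ))) x
      (EuclideanSpace.single i (1 : ℝ))

section BallPoissonIntegral

open Set Filter Topology MeasureTheory Metric

/-- The sum over the coordinate directions of the centred second differences of `u` with step `h`
at `x`. -/
noncomputable def secondDiff {N : ℕ} (u : EuclideanSpace ℝ (Fin N) → ℝ)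
    (x : EuclideanSpace ℝ (Fin N)) (h : ℝ) : ℝ :=
  ∑ i : Fin N, (u (x + h • EuclideanSpace.single i (1 : ℝ))
    + u (x - h • EuclideanSpace.single i (1 : ℝ)) - 2 * u x)

/-- A weak form of harmonicity: the second differences are `o(h ^ 2)` at every point of `s`. -/
def DiffHarmonicOn {N : ℕ} (u : EuclideanSpace ℝ (Fin N) → ℝ)
    (s : Set (EuclideanSpace ℝ (Fin N))) : Prop :=
  ∀ x ∈ s, ∀ ε > 0, ∀ᶠ h in 𝓝 (0 : ℝ), |secondDiff u x h| ≤ ε * h ^ 2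

theorem DiffHarmonicOn.mono {N : ℕ} {u : EuclideanSpace ℝ (Fin N) → ℝ}
    {s t : Set (EuclideanSpace ℝ (Fin N))} (hu : DiffHarmonicOn u t) (hst : s ⊆ t) :
    DiffHarmonicOn u s := fun x hx => hu x (hst hx)

theorem DiffHarmonicOn.sub {N : ℕ} {u v : EuclideanSpace ℝ (Fin N) → ℝ}
    {s : Set (EuclideanSpace ℝ (Fin N))} (hu : DiffHarmonicOn u s) (hv : DiffHarmonicOn v s) :
    DiffHarmonicOn (fun x => u x - v x) s := by
  intro x hx ε hε
  filter_upwards [hu x hx (ε / 2) (by positivity), hv x hx (ε / 2) (by positivity)] with h h1 h2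
  have : secondDiff (fun x => u x - v x) x h = secondDiff u x h - secondDiff v x h := by
    simp only [secondDiff, ← Finset.sum_sub_distrib]
    exact Finset.sum_congr rfl fun i _ => by ring
  rw [this]
  calc _ ≤ |secondDiff u x h| + |secondDiff v x h| := abs_sub _ _
    _ ≤ _ := by linarith

theorem DiffHarmonicOn.const {N : ℕ} (c : ℝ) (s : Set (EuclideanSpace ℝ (Fin N))) :
    DiffHarmonicOn (fun _ => c) s := by
  intro x hx ε hε
  refine Eventually.of_forall fun h => ?_
  have : secondDiff (fun _ => c) x h = 0 := Finset.sum_eq_zero fun i _ => by ring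
  rw [this, abs_zero]
  positivity

theorem DiffHarmonicOn.comp_smul {N : ℕ} {u : EuclideanSpace ℝ (Fin N) → ℝ}
    {s : Set (EuclideanSpace ℝ (Fin N))} (hu : DiffHarmonicOn u s) (r : ℝ) :
    DiffHarmonicOn (fun x => u (r • x)) ((fun x => r • x) ⁻¹' s) := by
  intro x hx ε hε
  have ht : Tendsto (fun h : ℝ => r * h) (𝓝 0) (𝓝 0) := by
    have : Continuous fun h : ℝ => r * h := by fun_prop
    simpa using this.tendsto 0
  have hδ : 0 < ε / (r ^ 2 + 1) := by positivity
  filter_upwards [ht.eventually (hu (r • x) hx _ hδ)] with h h1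
  have : secondDiff (fun x => u (r • x)) x h = secondDiff u (r • x) (r * h) := by
    simp only [secondDiff, smul_add, smul_sub, smul_smul]
  rw [this]
  refine h1.trans ?_
  rw [div_mul_eq_mul_div, div_le_iff₀ (by positivity)]
  nlinarith [mul_nonneg hε.le (sq_nonneg h)]

/-- The weak maximum principle. -/
theorem DiffHarmonicOn.nonpos {N : ℕ} (hN : 0 < N) {u : EuclideanSpace ℝ (Fin N) → ℝ} {r : ℝ}
    (hu : DiffHarmonicOn u (ball 0 r)) (hc : ContinuousOn u (closedBall 0 r))
    (hb : ∀ x, ‖x‖ = r → u x ≤ 0) {x : EuclideanSpace ℝ (Fin N)} (hx : ‖x‖ ≤ r) : u x ≤ 0 := by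
  by_contra! hpos
  obtain ⟨ε, hε, hεr⟩ : ∃ ε > 0, ε * r ^ 2 < u x :=
    ⟨u x / (r ^ 2 + 1), by positivity, by
      rw [div_mul_eq_mul_div, div_lt_iff₀ (by positivity)]; nlinarith⟩
  have hwc : ContinuousOn (fun x => u x + ε * ‖x‖ ^ 2) (closedBall 0 r) := by fun_prop
  obtain ⟨z, hz, hmax⟩ := (isCompact_closedBall (0 : EuclideanSpace ℝ (Fin N)) r).exists_isMaxOn
    ⟨x, by simpa using hx⟩ hwc
  have hzr : ‖z‖ ≤ r := by simpa using hz
  have hxz := hmax (show x ∈ closedBall 0 r by simpa using hx)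
  simp only [mem_ofPred_eq] at hxz
  have hzlt : ‖z‖ < r := by
    refine lt_of_le_of_ne hzr fun h => ?_
    have := hb z h
    rw [h] at hxz
    nlinarith [sq_nonneg ‖x‖]
  have hev : ∀ᶠ h in 𝓝 (0 : ℝ), ∀ i : Fin N,
      z + h • EuclideanSpace.single i (1 : ℝ) ∈ closedBall 0 r ∧
      z - h • EuclideanSpace.single i (1 : ℝ) ∈ closedBall 0 r := by
    rw [eventually_all]
    intro i
    have h1 : Continuous fun h : ℝ => z + h • EuclideanSpace.single i (1 : ℝ) := by fun_prop
    have h2 : Continuous fun h : ℝ => z - h • EuclideanSpace.single i (1 : ℝ) := by fun_prop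
    have hn : closedBall (0 : EuclideanSpace ℝ (Fin N)) r ∈ 𝓝 z :=
      mem_of_superset (isOpen_ball.mem_nhds (by simpa using hzlt)) ball_subset_closedBall
    exact (h1.continuousAt.eventually_mem (by simpa using hn)).and
      (h2.continuousAt.eventually_mem (by simpa using hn))
  have hall := (hev.and (hu z (by simpa using hzlt) ε hε)).filter_mono
    (nhdsWithin_le_nhds (s := {(0 : ℝ)}ᶜ))
  obtain ⟨h, ⟨hmem, hsd⟩, hh0⟩ := (hall.and self_mem_nhdsWithin).exists
  have hh : 0 < h ^ 2 := by
    have : h ≠ 0 := hh0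
    positivity
  have hle : secondDiff u z h ≤ ∑ _i : Fin N, -(2 * ε * h ^ 2) := by
    refine Finset.sum_le_sum fun i _ => ?_
    have h1 := hmax (hmem i).1
    have h2 := hmax (hmem i).2
    simp only [mem_ofPred_eq] at h1 h2
    have hpar := parallelogram_law_with_norm ℝ z (h • EuclideanSpace.single i (1 : ℝ))
    have hnorm : ‖h • EuclideanSpace.single i (1 : ℝ)‖ ^ 2
        = h ^ 2 := by
      rw [norm_smul]; simp
    rw [hnorm] at hpar
    nlinarith
  simp only [Finset.sum_const, Finset.card_univ, Fintype.card_fin, nsmul_eq_mul] at hle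
  have hN1 : (1 : ℝ) ≤ N := by exact_mod_cast hN
  have := (abs_le.1 hsd).1
  nlinarith [mul_pos hε hh]

/-- Two weakly harmonic functions that are close on a sphere are close inside it. -/
theorem DiffHarmonicOn.abs_sub_le {N : ℕ} (hN : 0 < N) {u v : EuclideanSpace ℝ (Fin N) → ℝ}
    {r : ℝ} (hu : DiffHarmonicOn u (ball 0 r)) (hv : DiffHarmonicOn v (ball 0 r))
    (huc : ContinuousOn u (closedBall 0 r)) (hvc : ContinuousOn v (closedBall 0 r)) {ε : ℝ}
    (hb : ∀ x, ‖x‖ = r → |u x - v x| ≤ ε) {x : EuclideanSpace ℝ (Fin N)} (hx : ‖x‖ ≤ r) :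
    |u x - v x| ≤ ε := by
  have h1 := ((hu.sub hv).sub (.const ε _)).nonpos hN (by fun_prop)
    (fun x hx => by linarith [(abs_le.1 (hb x hx)).2]) hx
  have h2 := ((hv.sub hu).sub (.const ε _)).nonpos hN (by fun_prop)
    (fun x hx => by linarith [(abs_le.1 (hb x hx)).1]) hx
  exact abs_le.2 ⟨by linarith, by linarith⟩

/-- The error of the centred second difference is controlled by the oscillation of the second
derivative. -/
theorem abs_second_difference_sub_le {f f' f'' : ℝ → ℝ} {h c ε : ℝ} (hh : 0 ≤ h)
    (hf : ∀ t, |t| ≤ h → HasDerivAt f (f' t) t) (hf' : ∀ t, |t| ≤ h → HasDerivAt f' (f'' t) t)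
    (hε : ∀ t, |t| ≤ h → |f'' t - c| ≤ ε) :
    |f h + f (-h) - 2 * f 0 - c * h ^ 2| ≤ 2 * ε * h ^ 2 := by
  have hε0 : 0 ≤ ε := (abs_nonneg _).trans (hε 0 (by simpa using hh))
  have habs : ∀ t ∈ Icc (-h) h, |t| ≤ h := fun t ht => abs_le.2 ht
  have key : ∀ t ∈ Icc 0 h, ‖f' t - f' (-t) - 2 * c * t‖ ≤ 2 * ε * h := by
    intro t ht
    have := (convex_Icc (-h) h).norm_image_sub_le_of_norm_hasDerivWithin_le
      (f := fun t => f' t - c * t) (f' := fun t => f'' t - c) (C := ε)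
      (fun s hs => ((hf' s (habs s hs)).sub
        ((hasDerivAt_id s).const_mul c |>.congr_deriv (mul_one c))).hasDerivWithinAt)
      (fun s hs => hε s (habs s hs)) (x := -t) (y := t)
      ⟨by linarith [ht.2], by linarith [ht.1]⟩ ⟨by linarith [ht.1], ht.2⟩
    have e1 : f' t - c * t - (f' (-t) - c * -t) = f' t - f' (-t) - 2 * c * t := by ring
    rw [e1] at this
    refine this.trans ?_
    have : ‖t - -t‖ ≤ 2 * h := by
      rw [Real.norm_eq_abs, abs_of_nonneg (by linarith [ht.1])]; linarith [ht.2]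
    nlinarith
  have := (convex_Icc 0 h).norm_image_sub_le_of_norm_hasDerivWithin_le
    (f := fun t => f t + f (-t) - c * t ^ 2) (f' := fun t => f' t - f' (-t) - 2 * c * t)
    (C := 2 * ε * h)
    (fun s hs => by
      have h1 := hf s (habs s ⟨by linarith [hs.1], hs.2⟩)
      have h2 := (hf (-s) (habs (-s) ⟨by linarith [hs.2], by linarith [hs.1, hs.2]⟩)).scomp s
        (hasDerivAt_neg s)
      refine (((h1.add h2).sub ((hasDerivAt_pow 2 s).const_mul c)).congr_deriv
        ?_).hasDerivWithinAt
      simp; ring)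
    key (x := 0) (y := h) ⟨le_rfl, hh⟩ ⟨hh, le_rfl⟩
  have e : f h + f (-h) - c * h ^ 2 - (f 0 + f (-0) - c * 0 ^ 2)
      = f h + f (-h) - 2 * f 0 - c * h ^ 2 := by
    rw [neg_zero]; ring
  rw [e, sub_zero, Real.norm_of_nonneg hh] at this
  simpa [pow_two, mul_assoc] using this

/-- A family of harmonic functions with jointly continuous second derivatives, parametrised by a
compact space, has uniformly small second differences. -/
theorem eventually_abs_secondDiff_le {N : ℕ} {Y : Type*} [TopologicalSpace Y] [CompactSpace Y]
    {s : Set (EuclideanSpace ℝ (Fin N))} (hs : IsOpen s)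
    {k : EuclideanSpace ℝ (Fin N) → Y → ℝ} {k₁ k₂ : Fin N → EuclideanSpace ℝ (Fin N) → Y → ℝ}
    (h₁ : ∀ i, ∀ x ∈ s, ∀ y,
      HasDerivAt (fun t : ℝ => k (x + t • EuclideanSpace.single i (1 : ℝ)) y) (k₁ i x y) 0)
    (h₂ : ∀ i, ∀ x ∈ s, ∀ y,
      HasDerivAt (fun t : ℝ => k₁ i (x + t • EuclideanSpace.single i (1 : ℝ)) y) (k₂ i x y) 0)
    (hc : ∀ i, ContinuousOn (Function.uncurry (k₂ i)) (s ×ˢ univ))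
    (hsum : ∀ x ∈ s, ∀ y, ∑ i, k₂ i x y = 0)
    {x : EuclideanSpace ℝ (Fin N)} (hx : x ∈ s) {ε : ℝ} (hε : 0 < ε) :
    ∀ᶠ h in 𝓝 (0 : ℝ), ∀ y, |secondDiff (fun x => k x y) x h| ≤ ε * h ^ 2 := by
  set η : ℝ := ε / (2 * (N + 1)) with hη
  have hη0 : 0 < η := by positivity
  have hnear : ∀ᶠ x' in 𝓝 x, x' ∈ s ∧ ∀ i : Fin N, ∀ y, |k₂ i x' y - k₂ i x y| ≤ η := by
    refine (hs.eventually_mem hx).and ?_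
    rw [eventually_all]
    intro i
    obtain ⟨v, hv, hvy⟩ := isCompact_univ.mem_uniformity_of_prod (hc i) hx
      (Metric.dist_mem_uniformity hη0)
    rw [hs.nhdsWithin_eq hx] at hv
    filter_upwards [hv] with x' hx' y
    have := hvy x' hx' y (mem_univ y)
    simp only [mem_ofPred_eq, Real.dist_eq] at this
    exact this.le
  obtain ⟨δ, hδ, hball⟩ := Metric.eventually_nhds_iff.1 hnear
  have hline : ∀ i : Fin N, ∀ t : ℝ, |t| < δ →
      dist (x + t • EuclideanSpace.single i (1 : ℝ)) x < δ := by
    intro i t ht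
    rw [dist_eq_norm, add_sub_cancel_left, norm_smul]
    simpa using ht
  filter_upwards [Metric.ball_mem_nhds (0 : ℝ) hδ] with h hh y
  have hh' : |h| < δ := by simpa using hh
  have hterm : ∀ i : Fin N, |k (x + h • EuclideanSpace.single i (1 : ℝ)) y
      + k (x - h • EuclideanSpace.single i (1 : ℝ)) y - 2 * k x y - k₂ i x y * h ^ 2|
      ≤ 2 * η * h ^ 2 := by
    intro i
    have shift : ∀ (g : EuclideanSpace ℝ (Fin N) → ℝ) (t d : ℝ),
        HasDerivAt (fun τ : ℝ => g (x + t • EuclideanSpace.single i (1 : ℝ)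
          + τ • EuclideanSpace.single i (1 : ℝ))) d 0 →
        HasDerivAt (fun τ : ℝ => g (x + τ • EuclideanSpace.single i (1 : ℝ))) d t := by
      intro g t d hd
      have hd' := (HasDerivAt.comp_sub_const (a := t) t (by simpa using hd))
      refine hd'.congr_of_eventuallyEq (Eventually.of_forall fun τ => ?_)
      dsimp only
      rw [add_assoc, ← add_smul, add_sub_cancel]
    have := abs_second_difference_sub_le (h := |h|) (c := k₂ i x y) (ε := η)
      (f := fun t => k (x + t • EuclideanSpace.single i (1 : ℝ)) y)
      (f' := fun t => k₁ i (x + t • EuclideanSpace.single i (1 : ℝ)) y)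
      (f'' := fun t => k₂ i (x + t • EuclideanSpace.single i (1 : ℝ)) y) (abs_nonneg h)
      (fun t ht => shift (fun x => k x y) t _
        (h₁ i _ (hball (hline i t (ht.trans_lt hh'))).1 y))
      (fun t ht => shift (fun x => k₁ i x y) t _
        (h₂ i _ (hball (hline i t (ht.trans_lt hh'))).1 y))
      (fun t ht => (hball (hline i t (ht.trans_lt hh'))).2 i y)
    rw [sq_abs, zero_smul, add_zero] at this
    rcases abs_choice h with e | e <;> rw [e] at this
    · simpa [sub_eq_add_neg] using this
    · simpa [sub_eq_add_neg, add_comm] using this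
  have hsd : secondDiff (fun x => k x y) x h
      = ∑ i : Fin N, (k (x + h • EuclideanSpace.single i (1 : ℝ)) y
      + k (x - h • EuclideanSpace.single i (1 : ℝ)) y - 2 * k x y - k₂ i x y * h ^ 2) := by
    rw [Finset.sum_sub_distrib, ← Finset.sum_mul, hsum x hx y]
    simp [secondDiff]
  rw [hsd]
  calc _ ≤ ∑ _i : Fin N, 2 * η * h ^ 2 :=
        (Finset.abs_sum_le_sum_abs _ _).trans (Finset.sum_le_sum fun i _ => hterm i)
    _ = N * (2 * η) * h ^ 2 := by simp [mul_assoc]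
    _ ≤ ε * h ^ 2 := by
        gcongr
        rw [hη]
        field_simp
        linarith

theorem diffHarmonicOn_of_laplacian_eq_zero {N : ℕ} {ψ : EuclideanSpace ℝ (Fin N) → ℝ}
    {s : Set (EuclideanSpace ℝ (Fin N))} (hs : IsOpen s) (hψ : ContDiffOn ℝ 2 ψ s)
    (hharm : ∀ x ∈ s, laplacian ψ x = 0) : DiffHarmonicOn ψ s := by
  intro x hx ε hε
  have hd : ∀ (g : EuclideanSpace ℝ (Fin N) → ℝ) (x e : EuclideanSpace ℝ (Fin N)),
      DifferentiableAt ℝ g x → HasDerivAt (fun t : ℝ => g (x + t • e)) (fderiv ℝ g x e) 0 := by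
    intro g x e hg
    exact (hg.hasFDerivAt.hasLineDerivAt e)
  have h1 : ContDiffOn ℝ 1 (fderiv ℝ ψ) s := hψ.fderiv_of_isOpen hs (by norm_num)
  have h2 : ∀ i : Fin N, ContDiffOn ℝ 1
      (fun y => fderiv ℝ ψ y (EuclideanSpace.single i (1 : ℝ))) s :=
    fun i => h1.clm_apply contDiffOn_const
  have h3 : ∀ i : Fin N, ContinuousOn (fun x => fderiv ℝ (fun y => fderiv ℝ ψ y
      (EuclideanSpace.single i (1 : ℝ))) x (EuclideanSpace.single i (1 : ℝ))) s :=
    fun i => ((h2 i).continuousOn_fderiv_of_isOpen hs le_rfl).clm_apply continuousOn_const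
  have := eventually_abs_secondDiff_le (Y := Unit) hs (k := fun x _ => ψ x)
    (k₁ := fun i x _ => fderiv ℝ ψ x (EuclideanSpace.single i (1 : ℝ)))
    (k₂ := fun i x _ => fderiv ℝ (fun y => fderiv ℝ ψ y
      (EuclideanSpace.single i (1 : ℝ))) x (EuclideanSpace.single i (1 : ℝ)))
    (fun i x hx _ => hd _ _ _ ((hψ.differentiableOn (by norm_num)).differentiableAt
      (hs.mem_nhds hx)))
    (fun i x hx _ => hd (fun y => fderiv ℝ ψ y (EuclideanSpace.single i (1 : ℝ))) _ _
      (((h2 i).differentiableOn (by norm_num)).differentiableAt (hs.mem_nhds hx)))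
    (fun i => (h3 i).comp continuousOn_fst fun p hp => hp.1)
    (fun x hx _ => hharm x hx) hx hε
  exact this.mono fun h hh => hh ()

/-- The Poisson kernel of the unit ball, normalised to take the value one at the centre. -/
noncomputable def ballKernel {N : ℕ} (x y : EuclideanSpace ℝ (Fin N)) : ℝ :=
  (1 - ‖x‖ ^ 2) * (‖x - y‖ ^ 2) ^ (-(N : ℝ) / 2)

theorem norm_sub_sq_pos {N : ℕ} {x y : EuclideanSpace ℝ (Fin N)} (hx : ‖x‖ < 1) (hy : ‖y‖ = 1) :
    0 < ‖x - y‖ ^ 2 := by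
  have : x - y ≠ 0 := by
    rw [sub_ne_zero]
    rintro rfl
    linarith
  positivity

theorem ballKernel_nonneg {N : ℕ} {x : EuclideanSpace ℝ (Fin N)} (hx : ‖x‖ < 1)
    (y : EuclideanSpace ℝ (Fin N)) : 0 ≤ ballKernel x y :=
  mul_nonneg (by nlinarith [norm_nonneg x]) (by positivity)

theorem ballKernel_zero {N : ℕ} {y : EuclideanSpace ℝ (Fin N)} (hy : ‖y‖ = 1) :
    ballKernel 0 y = 1 := by
  simp [ballKernel, hy]

theorem ballKernel_map {N : ℕ} (g : EuclideanSpace ℝ (Fin N) ≃ₗᵢ[ℝ] EuclideanSpace ℝ (Fin N))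
    (x y : EuclideanSpace ℝ (Fin N)) : ballKernel (g x) (g y) = ballKernel x y := by
  simp [ballKernel, ← map_sub]

theorem norm_smul_sub_sq {N : ℕ} {x y : EuclideanSpace ℝ (Fin N)} (hx : ‖x‖ = 1) (hy : ‖y‖ = 1)
    (r : ℝ) : ‖r • x - y‖ ^ 2 = 1 - 2 * r * ⟪x, y⟫ + r ^ 2 := by
  rw [norm_sub_sq_real, norm_smul, hx, hy, real_inner_smul_left, mul_one, Real.norm_eq_abs, sq_abs]
  ring

theorem ballKernel_smul {N : ℕ} {x y : EuclideanSpace ℝ (Fin N)} (hx : ‖x‖ = 1) (hy : ‖y‖ = 1)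
    (r : ℝ) : ballKernel (r • x) y
      = (1 - r ^ 2) * (1 - 2 * r * ⟪x, y⟫ + r ^ 2) ^ (-(N : ℝ) / 2) := by
  rw [ballKernel, norm_smul_sub_sq hx hy, norm_smul, hx, mul_one, Real.norm_eq_abs, sq_abs]

theorem ballKernel_smul_comm {N : ℕ} {x y : EuclideanSpace ℝ (Fin N)} (hx : ‖x‖ = 1)
    (hy : ‖y‖ = 1) (r : ℝ) : ballKernel (r • x) y = ballKernel (r • y) x := by
  rw [ballKernel_smul hx hy, ballKernel_smul hy hx, real_inner_comm]

theorem continuousOn_rpow_norm_sub {N : ℕ} (a : ℝ) :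
    ContinuousOn (fun p : EuclideanSpace ℝ (Fin N) × sphere (0 : EuclideanSpace ℝ (Fin N)) 1 =>
      (‖p.1 - p.2‖ ^ 2) ^ a) (ball 0 1 ×ˢ univ) := by
  refine ContinuousOn.rpow_const (by fun_prop) fun p hp => Or.inl (ne_of_gt ?_)
  exact norm_sub_sq_pos (by simpa using hp.1) (by simp)

theorem continuousOn_ballKernel {N : ℕ} :
    ContinuousOn (fun p : EuclideanSpace ℝ (Fin N) × sphere (0 : EuclideanSpace ℝ (Fin N)) 1 =>
      ballKernel p.1 (p.2 : EuclideanSpace ℝ (Fin N))) (ball 0 1 ×ˢ univ) :=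
  ContinuousOn.mul (by fun_prop) (continuousOn_rpow_norm_sub _)

theorem ballKernel_smul_ge {N : ℕ} {x y : EuclideanSpace ℝ (Fin N)} (hx : ‖x‖ = 1)
    (hy : ‖y‖ = 1) {r : ℝ} (hr : 0 ≤ r) (hr1 : r < 1) :
    (1 - r) * 4 ^ (-(N : ℝ) / 2) ≤ ballKernel (r • x) y := by
  have hlt : ‖r • x‖ < 1 := by rwa [norm_smul, hx, mul_one, Real.norm_of_nonneg hr]
  have hpos := norm_sub_sq_pos hlt hy
  have hle : ‖r • x - y‖ ^ 2 ≤ 4 := by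
    have : ‖r • x - y‖ ≤ 2 := (norm_sub_le _ _).trans (by linarith)
    nlinarith [norm_nonneg (r • x - y)]
  have hmono := Real.rpow_le_rpow_of_nonpos hpos hle
    (show -(N : ℝ) / 2 ≤ 0 by
      have : (0 : ℝ) ≤ N := by positivity
      linarith)
  rw [ballKernel]
  refine mul_le_mul ?_ hmono (by positivity) ?_
  · rw [norm_smul, hx, mul_one, Real.norm_of_nonneg hr]; nlinarith
  · nlinarith [norm_nonneg (r • x)]

theorem ballKernel_smul_mul_le {N : ℕ} {x y : EuclideanSpace ℝ (Fin N)} (hx : ‖x‖ = 1)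
    (hy : ‖y‖ = 1) {r : ℝ} (hr : 0 ≤ r) (hr1 : r < 1) :
    ballKernel (r • x) y * ‖y - x‖ ^ N ≤ 2 ^ N * (1 - r ^ 2) := by
  have hn : ‖r • x‖ = r := by rw [norm_smul, hx, mul_one, Real.norm_of_nonneg hr]
  have hpos := norm_sub_sq_pos (hn.trans_lt hr1) hy
  have hd : 0 < ‖r • x - y‖ := by
    rcases (norm_nonneg (r • x - y)).lt_or_eq with h | h
    · exact h
    · rw [← h] at hpos; norm_num at hpos
  have h1 : 1 - r ≤ ‖r • x - y‖ := by
    have := norm_sub_norm_le y (r • x)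
    rw [hn, hy, norm_sub_rev] at this
    exact this
  have h2 : ‖y - x‖ ≤ 2 * ‖r • x - y‖ := by
    have e : y - x = (y - r • x) - (1 - r) • x := by module
    have h3 : ‖(1 - r) • x‖ = 1 - r := by
      rw [norm_smul, hx, mul_one, Real.norm_of_nonneg (by linarith)]
    calc ‖y - x‖ ≤ ‖y - r • x‖ + ‖(1 - r) • x‖ := by rw [e]; exact norm_sub_le _ _
      _ ≤ _ := by rw [h3, norm_sub_rev]; linarith
  have h3 : (‖r • x - y‖ ^ 2) ^ (-(N : ℝ) / 2) * ‖r • x - y‖ ^ N = 1 := by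
    rw [← Real.rpow_natCast (‖r • x - y‖) 2, ← Real.rpow_mul hd.le,
      ← Real.rpow_natCast (‖r • x - y‖) N, ← Real.rpow_add hd]
    have : ((2 : ℕ) : ℝ) * (-(N : ℝ) / 2) + N = 0 := by push_cast; ring
    rw [this, Real.rpow_zero]
  calc ballKernel (r • x) y * ‖y - x‖ ^ N
      ≤ ballKernel (r • x) y * (2 * ‖r • x - y‖) ^ N :=
        mul_le_mul_of_nonneg_left (pow_le_pow_left₀ (norm_nonneg _) h2 N)
          (ballKernel_nonneg (hn.trans_lt hr1) y)
    _ = 2 ^ N * (1 - r ^ 2) * ((‖r • x - y‖ ^ 2) ^ (-(N : ℝ) / 2) * ‖r • x - y‖ ^ N) := by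
        rw [ballKernel, hn, mul_pow]; ring
    _ = _ := by rw [h3, mul_one]

theorem norm_add_smul_single_sq {N : ℕ} (x : EuclideanSpace ℝ (Fin N)) (i : Fin N) (t : ℝ) :
    ‖x + t • EuclideanSpace.single i (1 : ℝ)‖ ^ 2 = ‖x‖ ^ 2 + 2 * x i * t + t ^ 2 := by
  rw [norm_add_sq_real, norm_smul, real_inner_smul_right, EuclideanSpace.inner_single_right]
  simp
  ring

theorem hasDerivAt_norm_add_smul_single_sq {N : ℕ} (x : EuclideanSpace ℝ (Fin N)) (i : Fin N) :
    HasDerivAt (fun t : ℝ => ‖x + t • EuclideanSpace.single i (1 : ℝ)‖ ^ 2) (2 * x i) 0 := by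
  simp only [norm_add_smul_single_sq]
  have := (((hasDerivAt_id (0 : ℝ)).const_mul (2 * x i)).const_add (‖x‖ ^ 2)).add
    (hasDerivAt_pow 2 (0 : ℝ))
  exact this.congr_deriv (by simp)

/-- First partial derivatives of the Poisson kernel. -/
noncomputable def ballKernelDeriv {N : ℕ} (i : Fin N) (x y : EuclideanSpace ℝ (Fin N)) : ℝ :=
  -(2 * x i) * (‖x - y‖ ^ 2) ^ (-(N : ℝ) / 2)
    + (1 - ‖x‖ ^ 2) * (2 * (x i - y i) * (-(N : ℝ) / 2) * (‖x - y‖ ^ 2) ^ (-(N : ℝ) / 2 - 1))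

/-- Second pure partial derivatives of the Poisson kernel. -/
noncomputable def ballKernelDeriv₂ {N : ℕ} (i : Fin N) (x y : EuclideanSpace ℝ (Fin N)) : ℝ :=
  -2 * (‖x - y‖ ^ 2) ^ (-(N : ℝ) / 2)
    - 2 * (2 * x i) * (2 * (x i - y i) * (-(N : ℝ) / 2) * (‖x - y‖ ^ 2) ^ (-(N : ℝ) / 2 - 1))
    + (1 - ‖x‖ ^ 2) * (2 * (-(N : ℝ) / 2) * (‖x - y‖ ^ 2) ^ (-(N : ℝ) / 2 - 1)
      + 2 * (x i - y i) * (-(N : ℝ) / 2) *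
        (2 * (x i - y i) * (-(N : ℝ) / 2 - 1) * (‖x - y‖ ^ 2) ^ (-(N : ℝ) / 2 - 1 - 1)))

theorem hasDerivAt_rpow_norm_sub {N : ℕ} {x y : EuclideanSpace ℝ (Fin N)} (hx : ‖x‖ < 1)
    (hy : ‖y‖ = 1) (i : Fin N) (a : ℝ) :
    HasDerivAt (fun t : ℝ => (‖x + t • EuclideanSpace.single i (1 : ℝ) - y‖ ^ 2) ^ a)
      (2 * (x i - y i) * a * (‖x - y‖ ^ 2) ^ (a - 1)) 0 := by
  have h := hasDerivAt_norm_add_smul_single_sq (x - y) i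
  simp only [sub_add_eq_add_sub] at h
  have := h.rpow_const (p := a) (Or.inl (by simpa using (norm_sub_sq_pos hx hy).ne'))
  simpa using this

theorem hasDerivAt_ballKernel {N : ℕ} {x y : EuclideanSpace ℝ (Fin N)} (hx : ‖x‖ < 1)
    (hy : ‖y‖ = 1) (i : Fin N) :
    HasDerivAt (fun t : ℝ => ballKernel (x + t • EuclideanSpace.single i (1 : ℝ)) y)
      (ballKernelDeriv i x y) 0 := by
  have := ((hasDerivAt_norm_add_smul_single_sq x i).const_sub 1).mul
    (hasDerivAt_rpow_norm_sub hx hy i (-(N : ℝ) / 2))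
  exact this.congr_deriv (by simp [ballKernelDeriv])

theorem hasDerivAt_ballKernelDeriv {N : ℕ} {x y : EuclideanSpace ℝ (Fin N)} (hx : ‖x‖ < 1)
    (hy : ‖y‖ = 1) (i : Fin N) :
    HasDerivAt (fun t : ℝ => ballKernelDeriv i (x + t • EuclideanSpace.single i (1 : ℝ)) y)
      (ballKernelDeriv₂ i x y) 0 := by
  have hlin : HasDerivAt (fun t : ℝ => (x + t • EuclideanSpace.single i (1 : ℝ)) i) 1 0 := by
    have := (hasDerivAt_id (0 : ℝ)).const_add (x i)
    refine this.congr_of_eventuallyEq (Eventually.of_forall fun t => by simp)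
  have h1 := (hlin.const_mul 2).neg.mul (hasDerivAt_rpow_norm_sub hx hy i (-(N : ℝ) / 2))
  have h2 := ((hasDerivAt_norm_add_smul_single_sq x i).const_sub 1).mul
    ((((hlin.sub_const (y i)).const_mul 2).mul_const (-(N : ℝ) / 2)).mul
      (hasDerivAt_rpow_norm_sub hx hy i (-(N : ℝ) / 2 - 1)))
  refine (h1.add h2).congr_deriv ?_
  simp [ballKernelDeriv₂]
  ring

theorem sum_ballKernelDeriv₂ {N : ℕ} {x y : EuclideanSpace ℝ (Fin N)} (hx : ‖x‖ < 1)
    (hy : ‖y‖ = 1) : ∑ i, ballKernelDeriv₂ i x y = 0 := by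
  have hpos := norm_sub_sq_pos hx hy
  have hz : ∑ i, (x i - y i) ^ 2 = ‖x - y‖ ^ 2 := by
    rw [EuclideanSpace.real_norm_sq_eq]; simp
  have hxz : ∑ i, x i * (x i - y i) = (‖x - y‖ ^ 2 - (1 - ‖x‖ ^ 2)) / 2 := by
    have e : ∑ i, x i * (x i - y i) = ⟪x, x - y⟫ := by
      rw [PiLp.inner_apply]
      exact Finset.sum_congr rfl fun i _ => by simp [mul_comm]
    rw [e, inner_sub_right, norm_sub_sq_real, hy, real_inner_self_eq_norm_sq]
    ring
  have e1 : (‖x - y‖ ^ 2) ^ (-(N : ℝ) / 2)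
      = ‖x - y‖ ^ 2 * (‖x - y‖ ^ 2) ^ (-(N : ℝ) / 2 - 1) := by
    rw [Real.rpow_sub_one hpos.ne', mul_div_cancel₀ _ hpos.ne']
  have e2 : (‖x - y‖ ^ 2) ^ (-(N : ℝ) / 2 - 1)
      = ‖x - y‖ ^ 2 * (‖x - y‖ ^ 2) ^ (-(N : ℝ) / 2 - 1 - 1) := by
    rw [Real.rpow_sub_one hpos.ne' (-(N : ℝ) / 2 - 1), mul_div_cancel₀ _ hpos.ne']
  have hsum : ∑ i, ballKernelDeriv₂ i x y
      = ∑ _i : Fin N, (-2 * (‖x - y‖ ^ 2) ^ (-(N : ℝ) / 2)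
          - (1 - ‖x‖ ^ 2) * N * (‖x - y‖ ^ 2) ^ (-(N : ℝ) / 2 - 1))
        + 4 * N * (‖x - y‖ ^ 2) ^ (-(N : ℝ) / 2 - 1) * ∑ i, x i * (x i - y i)
        + (1 - ‖x‖ ^ 2) * (N * (N + 2)) * (‖x - y‖ ^ 2) ^ (-(N : ℝ) / 2 - 1 - 1)
          * ∑ i, (x i - y i) ^ 2 := by
    rw [Finset.mul_sum, Finset.mul_sum, ← Finset.sum_add_distrib, ← Finset.sum_add_distrib]
    refine Finset.sum_congr rfl fun i _ => ?_
    rw [ballKernelDeriv₂]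
    ring
  rw [hsum, hz, hxz, e1, e2]
  simp
  ring

theorem continuousOn_ballKernelDeriv₂ {N : ℕ} (i : Fin N) :
    ContinuousOn (fun p : EuclideanSpace ℝ (Fin N) × sphere (0 : EuclideanSpace ℝ (Fin N)) 1 =>
      ballKernelDeriv₂ i p.1 (p.2 : EuclideanSpace ℝ (Fin N))) (ball 0 1 ×ˢ univ) := by
  have h0 := continuousOn_rpow_norm_sub (N := N) (-(N : ℝ) / 2)
  have h1 := continuousOn_rpow_norm_sub (N := N) (-(N : ℝ) / 2 - 1)
  have h2 := continuousOn_rpow_norm_sub (N := N) (-(N : ℝ) / 2 - 1 - 1)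
  have hx : ContinuousOn (fun p : EuclideanSpace ℝ (Fin N) ×
      sphere (0 : EuclideanSpace ℝ (Fin N)) 1 => p.1 i) (ball 0 1 ×ˢ univ) := by fun_prop
  have hy : ContinuousOn (fun p : EuclideanSpace ℝ (Fin N) ×
      sphere (0 : EuclideanSpace ℝ (Fin N)) 1 => (p.2 : EuclideanSpace ℝ (Fin N)) i)
      (ball 0 1 ×ˢ univ) := by fun_prop
  unfold ballKernelDeriv₂
  fun_prop

/-- Invariance of a measure on the unit sphere under all linear isometries. -/
def IsometryInvariant {N : ℕ} (σ : Measure (sphere (0 : EuclideanSpace ℝ (Fin N)) 1)) : Prop :=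
  ∀ (g : EuclideanSpace ℝ (Fin N) ≃ₗᵢ[ℝ] EuclideanSpace ℝ (Fin N))
    (f : EuclideanSpace ℝ (Fin N) → ℝ), ∫ y, f (g y) ∂σ = ∫ y, f y ∂σ

/-- The Poisson integral of a function on the unit sphere. -/
noncomputable def poissonIntegral {N : ℕ} (σ : Measure (sphere (0 : EuclideanSpace ℝ (Fin N)) 1))
    (f : sphere (0 : EuclideanSpace ℝ (Fin N)) 1 → ℝ) (x : EuclideanSpace ℝ (Fin N)) : ℝ :=
  ∫ y, ballKernel x y * f y ∂σ

section PoissonIntegral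

variable {N : ℕ} {σ : Measure (sphere (0 : EuclideanSpace ℝ (Fin N)) 1)}
  {f : sphere (0 : EuclideanSpace ℝ (Fin N)) 1 → ℝ}

theorem norm_coe_sphere (y : sphere (0 : EuclideanSpace ℝ (Fin N)) 1) :
    ‖(y : EuclideanSpace ℝ (Fin N))‖ = 1 := by simp

theorem norm_smul_coe_sphere (y : sphere (0 : EuclideanSpace ℝ (Fin N)) 1) {r : ℝ} (hr : 0 ≤ r) :
    ‖r • (y : EuclideanSpace ℝ (Fin N))‖ = r := by
  rw [norm_smul, norm_coe_sphere, mul_one, Real.norm_of_nonneg hr]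

theorem continuous_ballKernel {x : EuclideanSpace ℝ (Fin N)} (hx : ‖x‖ < 1) :
    Continuous fun y : sphere (0 : EuclideanSpace ℝ (Fin N)) 1 =>
      ballKernel x (y : EuclideanSpace ℝ (Fin N)) :=
  continuousOn_ballKernel.comp_continuous (f := fun y => (x, y)) (by fun_prop)
    fun y => ⟨by simpa using hx, mem_univ _⟩

theorem Continuous.integrable_of_compactSpace {Y : Type*} [TopologicalSpace Y] [CompactSpace Y]
    [MeasurableSpace Y] [OpensMeasurableSpace Y] {μ : Measure Y} [IsFiniteMeasure μ] {f : Y → ℝ}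
    (hf : Continuous f) : Integrable f μ :=
  hf.integrable_of_hasCompactSupport (HasCompactSupport.of_compactSpace f)

theorem continuousOn_poissonIntegral [IsFiniteMeasure σ] (hf : Continuous f) :
    ContinuousOn (poissonIntegral σ f) (ball 0 1) := by
  refine continuousOn_integral_of_compact_support isCompact_univ ?_
    fun p y _ hy => absurd (mem_univ y) hy
  exact continuousOn_ballKernel.mul (hf.comp continuous_snd).continuousOn

theorem integrable_ballKernel_mul [IsFiniteMeasure σ] (hf : Continuous f)
    {x : EuclideanSpace ℝ (Fin N)} (hx : ‖x‖ < 1) :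
    Integrable (fun y : sphere (0 : EuclideanSpace ℝ (Fin N)) 1 => ballKernel x y * f y) σ :=
  ((continuous_ballKernel hx).mul hf).integrable_of_compactSpace

theorem secondDiff_poissonIntegral [IsFiniteMeasure σ] (hf : Continuous f)
    {x : EuclideanSpace ℝ (Fin N)} {h : ℝ} (hx : ‖x‖ < 1)
    (hp : ∀ i, ‖x + h • EuclideanSpace.single i (1 : ℝ)‖ < 1)
    (hm : ∀ i, ‖x - h • EuclideanSpace.single i (1 : ℝ)‖ < 1) :
    secondDiff (poissonIntegral σ f) x h = ∫ y : sphere (0 : EuclideanSpace ℝ (Fin N)) 1,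
      secondDiff (fun x => ballKernel x y * f y) x h ∂σ := by
  have hintegrable : ∀ i : Fin N, Integrable (fun y : sphere (0 : EuclideanSpace ℝ (Fin N)) 1 =>
      ballKernel (x + h • EuclideanSpace.single i (1 : ℝ)) y * f y
        + ballKernel (x - h • EuclideanSpace.single i (1 : ℝ)) y * f y
        - 2 * (ballKernel x y * f y)) σ := fun i =>
    ((integrable_ballKernel_mul hf (hp i)).add (integrable_ballKernel_mul hf (hm i))).sub
      ((integrable_ballKernel_mul hf hx).const_mul 2)
  unfold secondDiff
  rw [integral_finsetSum _ fun i _ => hintegrable i]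
  refine Finset.sum_congr rfl fun i _ => ?_
  have a1 := integrable_ballKernel_mul (σ := σ) hf (hp i)
  have a2 := integrable_ballKernel_mul (σ := σ) hf (hm i)
  have a3 := (integrable_ballKernel_mul (σ := σ) hf hx).const_mul 2
  have a4 := integral_sub (a1.add a2) a3
  simp only [Pi.add_apply] at a4
  rw [a4, integral_add a1 a2, integral_const_mul]
  rfl

theorem eventually_abs_secondDiff_ballKernel_le (hf : Continuous f)
    {x : EuclideanSpace ℝ (Fin N)} (hx : x ∈ ball 0 1) {ε : ℝ} (hε : 0 < ε) :
    ∀ᶠ h in 𝓝 (0 : ℝ), ∀ y : sphere (0 : EuclideanSpace ℝ (Fin N)) 1,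
      |secondDiff (fun x => ballKernel x y * f y) x h| ≤ ε * h ^ 2 := by
  refine eventually_abs_secondDiff_le (N := N) (Y := sphere (0 : EuclideanSpace ℝ (Fin N)) 1)
    (s := ball 0 1) isOpen_ball
    (k := fun x y => ballKernel x y * f y) (k₁ := fun i x y => ballKernelDeriv i x y * f y)
    (k₂ := fun i x y => ballKernelDeriv₂ i x y * f y) ?_ ?_ ?_ ?_ hx hε
  · intro i x hx y
    exact (hasDerivAt_ballKernel (mem_ball_zero_iff.1 hx) (norm_coe_sphere y) i).mul_const (f y)
  · intro i x hx y
    exact (hasDerivAt_ballKernelDeriv (mem_ball_zero_iff.1 hx) (norm_coe_sphere y) i).mul_const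
      (f y)
  · intro i
    exact (continuousOn_ballKernelDeriv₂ i).mul (hf.comp continuous_snd).continuousOn
  · intro x hx y
    rw [← Finset.sum_mul, sum_ballKernelDeriv₂ (mem_ball_zero_iff.1 hx) (norm_coe_sphere y),
      zero_mul]

theorem diffHarmonicOn_poissonIntegral [IsProbabilityMeasure σ] (hf : Continuous f) :
    DiffHarmonicOn (poissonIntegral σ f) (ball 0 1) := by
  intro x hx ε hε
  have hmem : ∀ᶠ h in 𝓝 (0 : ℝ), ∀ i : Fin N,
      x + h • EuclideanSpace.single i (1 : ℝ) ∈ ball 0 1 ∧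
      x - h • EuclideanSpace.single i (1 : ℝ) ∈ ball 0 1 := by
    rw [eventually_all]
    intro i
    have h1 : Continuous fun h : ℝ => x + h • EuclideanSpace.single i (1 : ℝ) := by fun_prop
    have h2 : Continuous fun h : ℝ => x - h • EuclideanSpace.single i (1 : ℝ) := by fun_prop
    have hb : ball (0 : EuclideanSpace ℝ (Fin N)) 1 ∈ 𝓝 x := isOpen_ball.mem_nhds hx
    have e1 : x + (0 : ℝ) • EuclideanSpace.single i (1 : ℝ) = x := by rw [zero_smul, add_zero]
    have e2 : x - (0 : ℝ) • EuclideanSpace.single i (1 : ℝ) = x := by rw [zero_smul, sub_zero]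
    have t1 := h1.tendsto 0
    have t2 := h2.tendsto 0
    rw [e1] at t1
    rw [e2] at t2
    exact (t1.eventually hb).and (t2.eventually hb)
  filter_upwards [eventually_abs_secondDiff_ballKernel_le hf hx hε, hmem] with h hh hm
  rw [secondDiff_poissonIntegral hf (mem_ball_zero_iff.1 hx)
    (fun i => mem_ball_zero_iff.1 (hm i).1) (fun i => mem_ball_zero_iff.1 (hm i).2),
    ← Real.norm_eq_abs]
  have h3 : ∀ y : sphere (0 : EuclideanSpace ℝ (Fin N)) 1,
      ‖secondDiff (fun x => ballKernel x y * f y) x h‖ ≤ ε * h ^ 2 := hh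
  have := norm_integral_le_of_norm_le_const (μ := σ) (Eventually.of_forall h3)
  rwa [probReal_univ, mul_one] at this

theorem poissonIntegral_one [IsProbabilityMeasure σ] (hN : 0 < N) (hσ : IsometryInvariant σ)
    {x : EuclideanSpace ℝ (Fin N)} (hx : ‖x‖ < 1) : poissonIntegral σ (fun _ => 1) x = 1 := by
  have hrot : ∀ (g : EuclideanSpace ℝ (Fin N) ≃ₗᵢ[ℝ] EuclideanSpace ℝ (Fin N)) x,
      poissonIntegral σ (fun _ => 1) (g x) = poissonIntegral σ (fun _ => 1) x := by
    intro g x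
    have := hσ g fun y => ballKernel (g x) y
    simpa [poissonIntegral, ballKernel_map] using this.symm
  have hsub : closedBall (0 : EuclideanSpace ℝ (Fin N)) ‖x‖ ⊆ ball 0 1 := closedBall_subset_ball hx
  have h := DiffHarmonicOn.abs_sub_le hN (r := ‖x‖) (ε := 0)
    (u := poissonIntegral σ fun _ => 1) (v := fun _ => poissonIntegral σ (fun _ => 1) x)
    ((diffHarmonicOn_poissonIntegral continuous_const).mono (ball_subset_closedBall.trans hsub))
    (.const _ _) ((continuousOn_poissonIntegral continuous_const).mono hsub) continuousOn_const
    (fun z hz => by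
      rw [← Submodule.reflection_sub hz.symm, hrot, sub_self, abs_zero])
    (x := 0) (by simp)
  have h0 : poissonIntegral σ (fun _ => 1) (0 : EuclideanSpace ℝ (Fin N)) = 1 := by
    simp [poissonIntegral, ballKernel_zero]
  have := abs_nonpos_iff.1 h
  linarith

theorem eventually_abs_poissonIntegral_sub_le [IsProbabilityMeasure σ] (hN : 0 < N)
    (hσ : IsometryInvariant σ) (hf : Continuous f) {ε : ℝ} (hε : 0 < ε) :
    ∀ᶠ r in 𝓝[<] (1 : ℝ), ∀ x : sphere (0 : EuclideanSpace ℝ (Fin N)) 1,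
      |poissonIntegral σ f (r • (x : EuclideanSpace ℝ (Fin N))) - f x| ≤ ε := by
  obtain ⟨M, hM⟩ := isCompact_univ.exists_bound_of_continuousOn hf.continuousOn
  obtain ⟨δ, hδ, hδf⟩ := Metric.uniformContinuous_iff.1
    (CompactSpace.uniformContinuous_of_continuous hf) (ε / 2) (by positivity)
  set C : ℝ := 2 * |M| / δ ^ N with hC
  have hC0 : 0 ≤ C := by positivity
  have hmod : ∀ x y : sphere (0 : EuclideanSpace ℝ (Fin N)) 1, |f y - f x|
      ≤ ε / 2 + C * ‖(y : EuclideanSpace ℝ (Fin N)) - x‖ ^ N := by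
    intro x y
    by_cases hxy : dist y x < δ
    · have h1 := (hδf hxy).le
      rw [Real.dist_eq] at h1
      have : 0 ≤ C * ‖(y : EuclideanSpace ℝ (Fin N)) - x‖ ^ N := by positivity
      linarith
    · have h1 : δ ≤ ‖(y : EuclideanSpace ℝ (Fin N)) - x‖ := by
        rw [← dist_eq_norm]; exact not_lt.1 hxy
      have h2 := pow_le_pow_left₀ hδ.le h1 N
      have h3 : 2 * |M| ≤ C * ‖(y : EuclideanSpace ℝ (Fin N)) - x‖ ^ N := by
        rw [hC, div_mul_eq_mul_div, le_div_iff₀ (by positivity)]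
        gcongr
      have h4 : |f y - f x| ≤ 2 * |M| := by
        have a := hM y (mem_univ _)
        have b := hM x (mem_univ _)
        rw [Real.norm_eq_abs] at a b
        have := abs_sub (f y) (f x)
        linarith [le_abs_self M]
      linarith
  have hlim : ∀ᶠ r in 𝓝[<] (1 : ℝ), C * (2 ^ N * (1 - r ^ 2)) < ε / 2 := by
    have : Continuous fun r : ℝ => C * (2 ^ N * (1 - r ^ 2)) := by fun_prop
    exact (this.continuousAt.eventually_lt continuousAt_const (by simp; positivity)).filter_mono
      nhdsWithin_le_nhds
  filter_upwards [hlim, self_mem_nhdsWithin, nhdsWithin_le_nhds (lt_mem_nhds zero_lt_one)]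
    with r hr hr1 hr0 x
  have hr1 : r < 1 := hr1
  have hx1 : ‖r • (x : EuclideanSpace ℝ (Fin N))‖ < 1 := by
    rwa [norm_smul_coe_sphere x hr0.le]
  have hK := continuous_ballKernel hx1
  have hone := poissonIntegral_one hN hσ hx1
  simp only [poissonIntegral, mul_one] at hone
  have e : poissonIntegral σ f (r • (x : EuclideanSpace ℝ (Fin N))) - f x
      = ∫ y : sphere (0 : EuclideanSpace ℝ (Fin N)) 1,
        ballKernel (r • (x : EuclideanSpace ℝ (Fin N))) y * (f y - f x) ∂σ := by
    simp only [mul_sub]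
    have a1 : Integrable (fun y : sphere (0 : EuclideanSpace ℝ (Fin N)) 1 =>
        ballKernel (r • (x : EuclideanSpace ℝ (Fin N))) y * f y) σ :=
      (hK.mul hf).integrable_of_compactSpace
    have a2 : Integrable (fun y : sphere (0 : EuclideanSpace ℝ (Fin N)) 1 =>
        ballKernel (r • (x : EuclideanSpace ℝ (Fin N))) y * f x) σ :=
      (hK.mul continuous_const).integrable_of_compactSpace
    rw [integral_sub a1 a2, integral_mul_const, hone, one_mul]
    rfl
  rw [e, ← Real.norm_eq_abs]
  calc _ ≤ ∫ y : sphere (0 : EuclideanSpace ℝ (Fin N)) 1,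
        (ballKernel (r • (x : EuclideanSpace ℝ (Fin N))) y * (ε / 2)
          + C * (2 ^ N * (1 - r ^ 2))) ∂σ := by
        refine norm_integral_le_of_norm_le
          ((hK.mul continuous_const).add continuous_const).integrable_of_compactSpace
          (Eventually.of_forall fun y => ?_)
        have hk0 := ballKernel_nonneg hx1 (y : EuclideanSpace ℝ (Fin N))
        rw [norm_mul, Real.norm_of_nonneg hk0, Real.norm_eq_abs]
        have h1 := mul_le_mul_of_nonneg_left (hmod x y) hk0
        have h2 := mul_le_mul_of_nonneg_left (ballKernel_smul_mul_le (norm_coe_sphere x)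
          (norm_coe_sphere y) hr0.le hr1) hC0
        nlinarith
    _ = ε / 2 + C * (2 ^ N * (1 - r ^ 2)) := by
        have a1 : Integrable (fun y : sphere (0 : EuclideanSpace ℝ (Fin N)) 1 =>
            ballKernel (r • (x : EuclideanSpace ℝ (Fin N))) y * (ε / 2)) σ :=
          (hK.mul continuous_const).integrable_of_compactSpace
        rw [integral_add a1 (integrable_const _), integral_mul_const, hone]
        simp
    _ ≤ ε := by linarith

/-- The Poisson integral reproduces weakly harmonic functions from their boundary values. -/
theorem poissonIntegral_eq [IsProbabilityMeasure σ] (hN : 0 < N) (hσ : IsometryInvariant σ)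
    {u : EuclideanSpace ℝ (Fin N) → ℝ} (hu : DiffHarmonicOn u (ball 0 1))
    (huc : ContinuousOn u (closedBall 0 1)) {x : EuclideanSpace ℝ (Fin N)} (hx : ‖x‖ < 1) :
    poissonIntegral σ (fun y => u y) x = u x := by
  have hf : Continuous fun y : sphere (0 : EuclideanSpace ℝ (Fin N)) 1 =>
      u (y : EuclideanSpace ℝ (Fin N)) :=
    huc.comp_continuous continuous_subtype_val fun y => sphere_subset_closedBall y.2
  refine eq_of_abs_sub_le_all fun ε hε => ?_
  obtain ⟨δ, hδ, hδu⟩ := Metric.uniformContinuousOn_iff.1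
    ((isCompact_closedBall (0 : EuclideanSpace ℝ (Fin N)) 1).uniformContinuousOn_of_continuous huc)
    (ε / 2) (by positivity)
  have hlt : ∀ᶠ r in 𝓝[<] (1 : ℝ), r < 1 := self_mem_nhdsWithin
  have hltx : ∀ᶠ r in 𝓝[<] (1 : ℝ), ‖x‖ < r := nhdsWithin_le_nhds (lt_mem_nhds hx)
  have hltδ : ∀ᶠ r in 𝓝[<] (1 : ℝ), 1 - δ < r := nhdsWithin_le_nhds (lt_mem_nhds (by linarith))
  obtain ⟨r, h1, hr1, hrx, hrδ⟩ :=
    ((eventually_abs_poissonIntegral_sub_le hN hσ hf (half_pos hε)).and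
    (hlt.and (hltx.and hltδ))).exists
  have hr0 : 0 < r := (norm_nonneg x).trans_lt hrx
  have hsub : closedBall (0 : EuclideanSpace ℝ (Fin N)) r ⊆ ball 0 1 := closedBall_subset_ball hr1
  refine DiffHarmonicOn.abs_sub_le hN (r := r)
    ((diffHarmonicOn_poissonIntegral hf).mono (ball_subset_closedBall.trans hsub))
    (hu.mono (ball_subset_closedBall.trans hsub))
    ((continuousOn_poissonIntegral hf).mono hsub)
    (huc.mono (hsub.trans ball_subset_closedBall)) (fun z hz => ?_) hrx.le
  have hy : ‖r⁻¹ • z‖ = 1 := by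
    rw [norm_smul, hz, norm_inv, Real.norm_of_nonneg hr0.le, inv_mul_cancel₀ hr0.ne']
  have hzy : z = r • (r⁻¹ • z) := by rw [smul_smul, mul_inv_cancel₀ hr0.ne', one_smul]
  have h2 := h1 ⟨r⁻¹ • z, by simpa using hy⟩
  simp only [← hzy] at h2
  have h3 := hδu (r⁻¹ • z) (by simpa using hy.le) z (by simpa using hz.le.trans hr1.le) (by
    have e : r⁻¹ • z - z = (1 - r) • (r⁻¹ • z) := by rw [sub_smul, one_smul, ← hzy]
    rw [dist_eq_norm, e, norm_smul, hy, mul_one, Real.norm_of_nonneg (by linarith)]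
    linarith)
  rw [Real.dist_eq] at h3
  calc _ ≤ _ := abs_sub_le _ (u (r⁻¹ • z)) _
    _ ≤ ε := by linarith

/-- The Poisson integrals form a semigroup. -/
theorem poissonIntegral_poissonIntegral [IsProbabilityMeasure σ] (hN : 0 < N)
    (hσ : IsometryInvariant σ) (hf : Continuous f) {r : ℝ} (hr : 0 ≤ r) (hr1 : r < 1)
    {x : EuclideanSpace ℝ (Fin N)} (hx : ‖x‖ < 1) :
    poissonIntegral σ (fun y => poissonIntegral σ f (r • (y : EuclideanSpace ℝ (Fin N)))) x
      = poissonIntegral σ f (r • x) := by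
  have hmaps : ∀ z : EuclideanSpace ℝ (Fin N), ‖z‖ ≤ 1 → ‖r • z‖ < 1 := by
    intro z hz
    rw [norm_smul, Real.norm_of_nonneg hr]
    nlinarith [norm_nonneg z]
  refine poissonIntegral_eq hN hσ (u := fun z => poissonIntegral σ f (r • z)) ?_ ?_ hx
  · refine ((diffHarmonicOn_poissonIntegral hf).comp_smul r).mono fun z hz => ?_
    simpa using hmaps z (by simpa using (mem_ball_zero_iff.1 hz).le)
  · refine (continuousOn_poissonIntegral hf).comp (by fun_prop) fun z hz => ?_
    simpa using hmaps z (by simpa using hz)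

theorem continuous_poissonIntegral_smul [IsFiniteMeasure σ] (hf : Continuous f) {r : ℝ}
    (hr : 0 ≤ r) (hr1 : r < 1) : Continuous fun x : sphere (0 : EuclideanSpace ℝ (Fin N)) 1 =>
      poissonIntegral σ f (r • (x : EuclideanSpace ℝ (Fin N))) :=
  (continuousOn_poissonIntegral hf).comp_continuous (by fun_prop)
    fun x => by rwa [mem_ball_zero_iff, norm_smul_coe_sphere x hr]

/-- The Poisson integral is a symmetric operator. -/
theorem integral_poissonIntegral_mul_comm [IsFiniteMeasure σ] (hf : Continuous f)
    {g : sphere (0 : EuclideanSpace ℝ (Fin N)) 1 → ℝ} (hg : Continuous g) {r : ℝ} (hr : 0 ≤ r)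
    (hr1 : r < 1) :
    ∫ x, g x * poissonIntegral σ f (r • (x : EuclideanSpace ℝ (Fin N))) ∂σ
      = ∫ x, f x * poissonIntegral σ g (r • (x : EuclideanSpace ℝ (Fin N))) ∂σ := by
  have hK : Continuous fun p : sphere (0 : EuclideanSpace ℝ (Fin N)) 1 ×
      sphere (0 : EuclideanSpace ℝ (Fin N)) 1 =>
      ballKernel (r • (p.1 : EuclideanSpace ℝ (Fin N))) (p.2 : EuclideanSpace ℝ (Fin N)) :=
    continuousOn_ballKernel.comp_continuous
      (f := fun p : sphere (0 : EuclideanSpace ℝ (Fin N)) 1 ×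
        sphere (0 : EuclideanSpace ℝ (Fin N)) 1 => (r • (p.1 : EuclideanSpace ℝ (Fin N)), p.2))
      (by fun_prop)
      fun p => ⟨by rwa [mem_ball_zero_iff, norm_smul_coe_sphere _ hr], mem_univ _⟩
  simp only [poissonIntegral, ← integral_const_mul]
  rw [integral_integral_swap]
  · refine integral_congr_ae (Eventually.of_forall fun x => integral_congr_ae
      (Eventually.of_forall fun y => ?_))
    dsimp only
    rw [ballKernel_smul_comm (norm_coe_sphere y) (norm_coe_sphere x)]
    ring
  · exact ((hg.comp continuous_fst).mul (hK.mul (hf.comp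
      continuous_snd))).integrable_of_compactSpace

end PoissonIntegral

/-- The radial derivative of the Poisson kernel in terms of the cosine of the angle. -/
noncomputable def ballKernelRadialDeriv (N : ℕ) (r s : ℝ) : ℝ :=
  -(2 * r) * (1 - 2 * r * s + r ^ 2) ^ (-(N : ℝ) / 2)
    + (1 - r ^ 2)
      * ((2 * r - 2 * s) * (-(N : ℝ) / 2) * (1 - 2 * r * s + r ^ 2) ^ (-(N : ℝ) / 2 - 1))

theorem one_sub_two_mul_add_sq_pos {r s : ℝ} (hr : 0 ≤ r) (hr1 : r < 1) (hs : s ≤ 1) :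
    0 < 1 - 2 * r * s + r ^ 2 := by
  nlinarith [mul_le_mul_of_nonneg_left hs hr, pow_pos (sub_pos.2 hr1) 2]

theorem hasDerivAt_ballKernel_smul {N : ℕ} {x y : EuclideanSpace ℝ (Fin N)} (hx : ‖x‖ = 1)
    (hy : ‖y‖ = 1) {r : ℝ} (hr : 0 ≤ r) (hr1 : r < 1) :
    HasDerivAt (fun r : ℝ => ballKernel (r • x) y) (ballKernelRadialDeriv N r ⟪x, y⟫) r := by
  have hs : ⟪x, y⟫ ≤ 1 := by simpa [hx, hy] using real_inner_le_norm x y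
  have hq := one_sub_two_mul_add_sq_pos hr hr1 hs
  simp only [ballKernel_smul hx hy]
  have h1 : HasDerivAt (fun r : ℝ => r ^ 2) (2 * r) r := by simpa using hasDerivAt_pow 2 r
  have h2 : HasDerivAt (fun r : ℝ => 1 - 2 * r * ⟪x, y⟫ + r ^ 2) (2 * r - 2 * ⟪x, y⟫) r :=
    (((((hasDerivAt_id r).const_mul 2).mul_const ⟪x, y⟫).const_sub 1).add h1).congr_deriv
      (by ring)
  exact ((h1.const_sub 1).mul (h2.rpow_const (Or.inl hq.ne'))).congr_deriv
    (by rw [ballKernelRadialDeriv])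

/-- Uniformly in the boundary points, the Poisson kernel deviates from one by a multiple of the
radius. -/
theorem exists_abs_ballKernel_smul_sub_one_le (N : ℕ) :
    ∃ C : ℝ, 0 ≤ C ∧ ∀ x y : EuclideanSpace ℝ (Fin N), ‖x‖ = 1 → ‖y‖ = 1 →
      ∀ r ∈ Icc (0 : ℝ) (1 / 2),
      |ballKernel (r • x) y - 1| ≤ C * r := by
  have hcont : ContinuousOn (fun p : ℝ × ℝ => ballKernelRadialDeriv N p.1 p.2)
      (Icc 0 (1 / 2) ×ˢ Icc (-1) 1) := by
    have hq : ∀ p ∈ Icc (0 : ℝ) (1 / 2) ×ˢ Icc (-1 : ℝ) 1, 1 - 2 * p.1 * p.2 + p.1 ^ 2 ≠ 0 :=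
      fun p hp => (one_sub_two_mul_add_sq_pos hp.1.1 (by linarith [hp.1.2]) hp.2.2).ne'
    have hp : ∀ a : ℝ, ContinuousOn (fun p : ℝ × ℝ => (1 - 2 * p.1 * p.2 + p.1 ^ 2) ^ a)
        (Icc 0 (1 / 2) ×ˢ Icc (-1) 1) := fun a =>
      ContinuousOn.rpow_const (by fun_prop) fun p hp => Or.inl (hq p hp)
    have h0 := hp (-(N : ℝ) / 2)
    have h1 := hp (-(N : ℝ) / 2 - 1)
    unfold ballKernelRadialDeriv
    fun_prop
  obtain ⟨C, hC⟩ := (isCompact_Icc.prod isCompact_Icc).exists_bound_of_continuousOn hcont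
  refine ⟨C, (norm_nonneg _).trans (hC (0, 0) ⟨by norm_num, by norm_num⟩), ?_⟩
  intro x y hx hy r hr
  have hs : ⟪x, y⟫ ∈ Icc (-1 : ℝ) 1 := abs_le.1 (by simpa [hx, hy] using abs_real_inner_le_norm x y)
  have := (convex_Icc (0 : ℝ) (1 / 2)).norm_image_sub_le_of_norm_hasDerivWithin_le
    (f := fun r : ℝ => ballKernel (r • x) y) (C := C)
    (fun t ht => (hasDerivAt_ballKernel_smul hx hy ht.1 (by linarith [ht.2])).hasDerivWithinAt)
    (fun t ht => hC (t, ⟪x, y⟫) ⟨ht, hs⟩) (left_mem_Icc.2 (by norm_num)) hr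
  simpa [ballKernel_zero, hy, abs_of_nonneg hr.1] using this

/-- A function on the positive half-line that is bounded below near infinity, `o(t)` from above at
zero, and at most doubles when its argument doubles, vanishes. -/
theorem eq_zero_of_le_two_mul {D : ℝ → ℝ} {m : ℝ} (hD : ∀ t, 0 < t → D (2 * t) ≤ 2 * D t)
    (hm : ∀ᶠ t in atTop, m ≤ D t) (ho : ∀ ε > 0, ∀ᶠ t in 𝓝[>] (0 : ℝ), D t ≤ ε * t)
    {t : ℝ} (ht : 0 < t) : D t = 0 := by
  have hk : ∀ k : ℕ, ∀ t, 0 < t → D (2 ^ k * t) ≤ 2 ^ k * D t := by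
    intro k
    induction k with
    | zero => intro t _; simp
    | succ k ih =>
      intro t ht
      have h1 := hD (2 ^ k * t) (by positivity)
      have h2 := ih t ht
      calc D (2 ^ (k + 1) * t) = D (2 * (2 ^ k * t)) := by congr 1; ring
        _ ≤ 2 * (2 ^ k * D t) := by linarith
        _ = _ := by ring
  apply le_antisymm
  · refine le_of_forall_pos_le_add fun ε hε => ?_
    have h1 : Tendsto (fun k : ℕ => (1 / 2 : ℝ) ^ k * t) atTop (𝓝[>] 0) := by
      refine tendsto_nhdsWithin_iff.2 ⟨?_, Eventually.of_forall fun k => ?_⟩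
      · simpa using (tendsto_pow_atTop_nhds_zero_of_lt_one (r := (1 / 2 : ℝ)) (by norm_num)
          (by norm_num)).mul_const t
      · exact mem_Ioi.2 (by positivity)
    obtain ⟨k, hk1⟩ := (h1.eventually (ho (ε / t) (by positivity))).exists
    have h2 := hk k ((1 / 2 : ℝ) ^ k * t) (by positivity)
    have e : (2 : ℝ) ^ k * ((1 / 2) ^ k * t) = t := by
      rw [← mul_assoc, ← mul_pow]; norm_num
    rw [e] at h2
    calc D t ≤ _ := h2
      _ ≤ 2 ^ k * (ε / t * ((1 / 2) ^ k * t)) := by gcongr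
      _ = ε / t * (2 ^ k * ((1 / 2) ^ k * t)) := by ring
      _ = 0 + ε := by rw [e]; field_simp; ring
  · by_contra! hneg
    have h2 : Tendsto (fun k : ℕ => (2 : ℝ) ^ k) atTop atTop :=
      tendsto_pow_atTop_atTop_of_one_lt one_lt_two
    obtain ⟨k, hk1, hk2⟩ := ((h2.eventually_gt_atTop (m / D t)).and
      ((h2.atTop_mul_const ht).eventually hm)).exists
    have h1 := hk k t ht
    rw [div_lt_iff_of_neg hneg] at hk1
    linarith

section Spectral

variable {N : ℕ} {σ : Measure (sphere (0 : EuclideanSpace ℝ (Fin N)) 1)}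
  {w : sphere (0 : EuclideanSpace ℝ (Fin N)) 1 → ℝ}

theorem integral_poissonIntegral_sq [IsProbabilityMeasure σ] (hN : 0 < N)
    (hσ : IsometryInvariant σ) (hw : Continuous w) {r : ℝ} (hr : 0 ≤ r) (hr1 : r < 1) :
    ∫ x, poissonIntegral σ w (r • (x : EuclideanSpace ℝ (Fin N))) ^ 2 ∂σ
      = ∫ x, w x * poissonIntegral σ w ((r ^ 2) • (x : EuclideanSpace ℝ (Fin N))) ∂σ := by
  have h := integral_poissonIntegral_mul_comm (σ := σ) hw
    (continuous_poissonIntegral_smul (σ := σ) hw hr hr1) hr hr1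
  simp only [← pow_two] at h
  rw [h]
  refine integral_congr_ae (Eventually.of_forall fun x => ?_)
  dsimp only
  rw [poissonIntegral_poissonIntegral hN hσ hw hr hr1
    ((norm_smul_coe_sphere x hr).trans_lt hr1), smul_smul, pow_two]

theorem integral_poissonIntegral_sub_sq [IsProbabilityMeasure σ] (hN : 0 < N)
    (hσ : IsometryInvariant σ) (hw : Continuous w) {r : ℝ} (hr : 0 ≤ r) (hr1 : r < 1) :
    ∫ x, (poissonIntegral σ w (r • (x : EuclideanSpace ℝ (Fin N))) - r * w x) ^ 2 ∂σ
      = ∫ x, w x * poissonIntegral σ w ((r ^ 2) • (x : EuclideanSpace ℝ (Fin N))) ∂σ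
        - 2 * r * ∫ x, w x * poissonIntegral σ w (r • (x : EuclideanSpace ℝ (Fin N))) ∂σ
        + r ^ 2 * ∫ x, w x ^ 2 ∂σ := by
  have hP := continuous_poissonIntegral_smul (σ := σ) hw hr hr1
  have i1 : Integrable (fun x : sphere (0 : EuclideanSpace ℝ (Fin N)) 1 =>
      poissonIntegral σ w (r • (x : EuclideanSpace ℝ (Fin N))) ^ 2) σ :=
    (hP.pow 2).integrable_of_compactSpace
  have i2 : Integrable (fun x : sphere (0 : EuclideanSpace ℝ (Fin N)) 1 =>
      2 * r * (w x * poissonIntegral σ w (r • (x : EuclideanSpace ℝ (Fin N))))) σ :=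
    (continuous_const.mul (hw.mul hP)).integrable_of_compactSpace
  have i3 : Integrable (fun x => r ^ 2 * w x ^ 2) σ :=
    (continuous_const.mul (hw.pow 2)).integrable_of_compactSpace
  have i4 : Integrable (fun x : sphere (0 : EuclideanSpace ℝ (Fin N)) 1 =>
      poissonIntegral σ w (r • (x : EuclideanSpace ℝ (Fin N))) ^ 2
        - 2 * r * (w x * poissonIntegral σ w (r • (x : EuclideanSpace ℝ (Fin N))))) σ := i1.sub i2
  rw [← integral_poissonIntegral_sq hN hσ hw hr hr1, ← integral_const_mul, ← integral_const_mul,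
    ← integral_sub i1 i2, ← integral_add i4 i3]
  exact integral_congr_ae (Eventually.of_forall fun x => by ring)

theorem poissonIntegral_eq_integral_sub_one [IsProbabilityMeasure σ] (hw : Continuous w)
    (hmean : ∫ x, w x ∂σ = 0) {x : EuclideanSpace ℝ (Fin N)} (hx : ‖x‖ < 1) :
    poissonIntegral σ w x = ∫ y : sphere (0 : EuclideanSpace ℝ (Fin N)) 1,
      (ballKernel x y - 1) * w y ∂σ := by
  simp only [sub_mul, one_mul]
  rw [integral_sub (integrable_ballKernel_mul hw hx) hw.integrable_of_compactSpace, hmean, sub_zero]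
  rfl

theorem exists_abs_poissonIntegral_smul_le [IsProbabilityMeasure σ] (hw : Continuous w)
    (hmean : ∫ x, w x ∂σ = 0) :
    ∃ C : ℝ, ∀ r ∈ Icc (0 : ℝ) (1 / 2), ∀ x : sphere (0 : EuclideanSpace ℝ (Fin N)) 1,
      |poissonIntegral σ w (r • (x : EuclideanSpace ℝ (Fin N)))| ≤ C * r := by
  obtain ⟨C, hC0, hC⟩ := exists_abs_ballKernel_smul_sub_one_le N
  obtain ⟨M, hM⟩ := isCompact_univ.exists_bound_of_continuousOn hw.continuousOn
  refine ⟨C * M, fun r hr x => ?_⟩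
  rw [poissonIntegral_eq_integral_sub_one hw hmean
    ((norm_smul_coe_sphere x hr.1).trans_lt (by linarith [hr.2])), ← Real.norm_eq_abs]
  have h : ∀ y : sphere (0 : EuclideanSpace ℝ (Fin N)) 1,
      ‖(ballKernel (r • (x : EuclideanSpace ℝ (Fin N))) y - 1) * w y‖ ≤ C * M * r := by
    intro y
    rw [norm_mul, Real.norm_eq_abs]
    have h1 := hC x y (norm_coe_sphere x) (norm_coe_sphere y) r hr
    calc _ ≤ C * r * M := mul_le_mul h1 (hM y (mem_univ _)) (norm_nonneg _)
          (mul_nonneg hC0 hr.1)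
      _ = _ := by ring
  have := norm_integral_le_of_norm_le_const (μ := σ) (Eventually.of_forall h)
  rwa [probReal_univ, mul_one] at this

/-- A mean zero function whose Poisson integrals attain the extremal Rayleigh quotient to first
order at the boundary is an eigenfunction of the Poisson semigroup. -/
theorem poissonIntegral_smul_eq_mul [IsProbabilityMeasure σ] [σ.IsOpenPosMeasure] (hN : 0 < N)
    (hσ : IsometryInvariant σ) (hw : Continuous w) (hmean : ∫ x, w x ∂σ = 0)
    (hray : ∀ ε > 0, ∀ᶠ r in 𝓝[<] (1 : ℝ), r * ∫ x, w x ^ 2 ∂σ - ε * (1 - r)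
      ≤ ∫ x, w x * poissonIntegral σ w (r • (x : EuclideanSpace ℝ (Fin N))) ∂σ)
    {r : ℝ} (hr : 0 < r) (hr1 : r < 1) (x : sphere (0 : EuclideanSpace ℝ (Fin N)) 1) :
    poissonIntegral σ w (r • (x : EuclideanSpace ℝ (Fin N))) = r * w x := by
  set F : ℝ → ℝ := fun r => ∫ x, w x * poissonIntegral σ w (r • (x : EuclideanSpace ℝ (Fin N))) ∂σ
    with hF
  set F₀ : ℝ := ∫ x, w x ^ 2 ∂σ with hF₀
  have hexpand : ∀ r : ℝ, 0 ≤ r → r < 1 →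
      ∫ x, (poissonIntegral σ w (r • (x : EuclideanSpace ℝ (Fin N))) - r * w x) ^ 2 ∂σ
        = F (r ^ 2) - 2 * r * F r + r ^ 2 * F₀ :=
    fun r h h1 => integral_poissonIntegral_sub_sq hN hσ hw h h1
  set D : ℝ → ℝ := fun t => F₀ - F (Real.exp (-t)) / Real.exp (-t) with hD
  have hexp2 : ∀ t : ℝ, Real.exp (-(2 * t)) = Real.exp (-t) ^ 2 := fun t => by
    rw [← Real.exp_nat_mul]; congr 1; push_cast; ring
  have hDexpand : ∀ t : ℝ, F (Real.exp (-t) ^ 2) - 2 * Real.exp (-t) * F (Real.exp (-t))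
      + Real.exp (-t) ^ 2 * F₀ = Real.exp (-t) ^ 2 * (2 * D t - D (2 * t)) := by
    intro t
    simp only [hD, hexp2]
    field_simp
    ring
  have hDzero : ∀ t, 0 < t → D t = 0 := by
    intro t ht
    obtain ⟨C, hC⟩ := exists_abs_poissonIntegral_smul_le hw hmean
    refine eq_zero_of_le_two_mul (m := F₀ - ∫ x, |w x| * C ∂σ) ?_ ?_ ?_ ht
    · intro t ht
      have h1 : 0 ≤ ∫ x, (poissonIntegral σ w (Real.exp (-t) • (x : EuclideanSpace ℝ (Fin N)))
          - Real.exp (-t) * w x) ^ 2 ∂σ := integral_nonneg fun x => sq_nonneg _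
      rw [hexpand _ (Real.exp_pos _).le (by simpa using ht), hDexpand] at h1
      linarith [nonneg_of_mul_nonneg_right h1 (by positivity : 0 < Real.exp (-t) ^ 2)]
    · have h0 : Tendsto (fun t : ℝ => Real.exp (-t)) atTop (𝓝 0) :=
        Real.tendsto_exp_neg_atTop_nhds_zero
      filter_upwards [h0.eventually (gt_mem_nhds (show (0 : ℝ) < 1 / 2 by norm_num))] with t ht
      have hpos := Real.exp_pos (-t)
      simp only [hD]
      gcongr
      rw [div_le_iff₀ hpos, ← integral_mul_const]
      refine integral_mono ((hw.mul (continuous_poissonIntegral_smul hw hpos.le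
        (by linarith))).integrable_of_compactSpace)
        ((hw.abs.mul continuous_const).mul continuous_const).integrable_of_compactSpace fun x => ?_
      calc _ ≤ |w x| * |poissonIntegral σ w (Real.exp (-t) • (x : EuclideanSpace ℝ (Fin N)))| := by
            rw [← abs_mul]; exact le_abs_self _
        _ ≤ |w x| * (C * Real.exp (-t)) := by
            gcongr
            exact hC _ ⟨hpos.le, ht.le⟩ x
        _ = _ := by ring
    · intro ε hε
      have h0 : Tendsto (fun t : ℝ => Real.exp (-t)) (𝓝[>] 0) (𝓝[<] 1) := by
        refine tendsto_nhdsWithin_iff.2 ⟨?_, ?_⟩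
        · have : Continuous fun t : ℝ => Real.exp (-t) := by fun_prop
          simpa using (this.tendsto 0).mono_left nhdsWithin_le_nhds
        · filter_upwards [self_mem_nhdsWithin] with t ht
          simpa using ht
      have hsmall : ∀ᶠ t in 𝓝[>] (0 : ℝ), t < 1 := nhdsWithin_le_nhds (gt_mem_nhds zero_lt_one)
      filter_upwards [h0.eventually (hray (ε / 2) (by positivity)), hsmall, self_mem_nhdsWithin]
        with t h1 h2 h3
      have h3 : 0 < t := h3
      have hpos := Real.exp_pos (-t)
      have h4 := Real.abs_exp_sub_one_le (x := t) (by rw [abs_of_pos h3]; exact h2.le)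
      rw [abs_of_pos h3] at h4
      have h5 := (abs_le.1 h4).2
      have h6 : Real.exp (-t) * Real.exp t = 1 := by rw [← Real.exp_add]; simp
      have h7 : 1 - Real.exp (-t) ≤ 2 * t * Real.exp (-t) := by nlinarith
      simp only [hD]
      rw [sub_le_iff_le_add, ← sub_le_iff_le_add', le_div_iff₀ hpos]
      have h8 : Real.exp (-t) * F₀ - ε / 2 * (1 - Real.exp (-t)) ≤ F (Real.exp (-t)) := h1
      nlinarith
  have hsq : ∫ x, (poissonIntegral σ w (r • (x : EuclideanSpace ℝ (Fin N))) - r * w x) ^ 2 ∂σ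
      = 0 := by
    have ht : 0 < -Real.log r := by linarith [Real.log_neg hr hr1]
    have he : Real.exp (-(-Real.log r)) = r := by rw [neg_neg, Real.exp_log hr]
    have h1 := hDexpand (-Real.log r)
    rw [he, hDzero _ ht, hDzero _ (by linarith)] at h1
    rw [hexpand r hr.le hr1, h1]
    ring
  have hcont : Continuous fun x : sphere (0 : EuclideanSpace ℝ (Fin N)) 1 =>
      (poissonIntegral σ w (r • (x : EuclideanSpace ℝ (Fin N))) - r * w x) ^ 2 :=
    ((continuous_poissonIntegral_smul hw hr.le hr1).sub (continuous_const.mul hw)).pow 2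
  have hae := (integral_eq_zero_iff_of_nonneg (fun x => sq_nonneg _)
    hcont.integrable_of_compactSpace).1 hsq
  have := congrFun ((Continuous.ae_eq_iff_eq σ hcont continuous_const).1 hae) x
  exact sub_eq_zero.1 (pow_eq_zero_iff two_ne_zero |>.1 this)

/-- Eigenfunctions of the Poisson semigroup of degree one are restrictions of linear functions. -/
theorem exists_eq_inner_of_poissonIntegral_smul_eq_mul [IsProbabilityMeasure σ] (hw : Continuous w)
    (hmean : ∫ x, w x ∂σ = 0)
    (hP : ∀ r : ℝ, 0 < r → r < 1 → ∀ x : sphere (0 : EuclideanSpace ℝ (Fin N)) 1,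
      poissonIntegral σ w (r • (x : EuclideanSpace ℝ (Fin N))) = r * w x) :
    ∃ a : EuclideanSpace ℝ (Fin N), ∀ x : sphere (0 : EuclideanSpace ℝ (Fin N)) 1,
      w x = ⟪a, (x : EuclideanSpace ℝ (Fin N))⟫ := by
  refine ⟨∫ y, ((N : ℝ) * w y) • (y : EuclideanSpace ℝ (Fin N)) ∂σ, fun x => ?_⟩
  have hi : Integrable (fun y : sphere (0 : EuclideanSpace ℝ (Fin N)) 1 =>
      ((N : ℝ) * w y) • (y : EuclideanSpace ℝ (Fin N))) σ := by
    refine Continuous.integrable_of_hasCompactSupport ?_ (HasCompactSupport.of_compactSpace _)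
    fun_prop
  rw [real_inner_comm, ← integral_inner hi]
  obtain ⟨C, hC0, hC⟩ := exists_abs_ballKernel_smul_sub_one_le N
  have hsmall : ∀ᶠ r in 𝓝[>] (0 : ℝ), r < 1 / 2 :=
    nhdsWithin_le_nhds (gt_mem_nhds (by norm_num))
  have hpos : ∀ᶠ r in 𝓝[>] (0 : ℝ), 0 < r := self_mem_nhdsWithin
  have hlim : Tendsto (fun r : ℝ => ∫ y : sphere (0 : EuclideanSpace ℝ (Fin N)) 1,
      r⁻¹ * (ballKernel (r • (x : EuclideanSpace ℝ (Fin N))) y - 1) * w y ∂σ) (𝓝[>] 0)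
      (𝓝 (∫ y : sphere (0 : EuclideanSpace ℝ (Fin N)) 1,
        ⟪(x : EuclideanSpace ℝ (Fin N)), ((N : ℝ) * w y) • (y : EuclideanSpace ℝ (Fin N))⟫ ∂σ)) :=
    by
    refine tendsto_integral_filter_of_dominated_convergence (fun y => C * |w y|) ?_ ?_ ?_ ?_
    · filter_upwards [hsmall, hpos] with r h1 h2
      have := continuous_ballKernel ((norm_smul_coe_sphere x h2.le).trans_lt (by linarith))
      exact ((continuous_const.mul (this.sub continuous_const)).mul hw).aestronglyMeasurable
    · filter_upwards [hsmall, hpos] with r h1 h2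
      refine Eventually.of_forall fun y => ?_
      rw [norm_mul, norm_mul, norm_inv, Real.norm_of_nonneg h2.le, Real.norm_eq_abs,
        Real.norm_eq_abs]
      gcongr
      rw [inv_mul_le_iff₀ h2, mul_comm r]
      exact hC x y (norm_coe_sphere x) (norm_coe_sphere y) r ⟨h2.le, h1.le⟩
    · exact (continuous_const.mul hw.abs).integrable_of_compactSpace
    · refine Eventually.of_forall fun y => ?_
      have h1 := (hasDerivAt_iff_tendsto_slope_zero.1 (hasDerivAt_ballKernel_smul
        (norm_coe_sphere x) (norm_coe_sphere y) le_rfl zero_lt_one)).mono_left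
        (nhdsWithin_mono 0 fun t (ht : 0 < t) => ht.ne')
      simp only [zero_add, zero_smul, ballKernel_zero (norm_coe_sphere y), smul_eq_mul] at h1
      have h2 := h1.mul_const (w y)
      have e : ballKernelRadialDeriv N 0 ⟪(x : EuclideanSpace ℝ (Fin N)), y⟫ * w y
          = ⟪(x : EuclideanSpace ℝ (Fin N)), ((N : ℝ) * w y) • (y : EuclideanSpace ℝ (Fin N))⟫ := by
        rw [real_inner_smul_right]
        simp [ballKernelRadialDeriv]
        ring
      rwa [e] at h2
  refine tendsto_nhds_unique_of_eventuallyEq tendsto_const_nhds hlim ?_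
  filter_upwards [hsmall, hpos] with r h1 h2
  have h3 := hP r h2 (by linarith) x
  rw [poissonIntegral_eq_integral_sub_one hw hmean
    ((norm_smul_coe_sphere x h2.le).trans_lt (by linarith))] at h3
  simp only [mul_assoc]
  rw [integral_const_mul, h3, inv_mul_cancel_left₀ h2.ne']

end Spectral

/-- The self-homeomorphism of the unit sphere induced by a linear isometry. -/
noncomputable def sphereHomeomorph {N : ℕ}
    (g : EuclideanSpace ℝ (Fin N) ≃ₗᵢ[ℝ] EuclideanSpace ℝ (Fin N)) :
    sphere (0 : EuclideanSpace ℝ (Fin N)) 1 ≃ₜ sphere (0 : EuclideanSpace ℝ (Fin N)) 1 where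
  toFun y := ⟨g y, by simp⟩
  invFun y := ⟨g.symm y, by simp⟩
  left_inv y := by simp
  right_inv y := by simp
  continuous_toFun := by fun_prop
  continuous_invFun := by fun_prop

open scoped Pointwise in
theorem measurePreserving_sphereHomeomorph {N : ℕ}
    (g : EuclideanSpace ℝ (Fin N) ≃ₗᵢ[ℝ] EuclideanSpace ℝ (Fin N)) :
    MeasurePreserving (sphereHomeomorph g)
      (volume : Measure (EuclideanSpace ℝ (Fin N))).toSphere
      (volume : Measure (EuclideanSpace ℝ (Fin N))).toSphere := by
  refine ⟨(sphereHomeomorph g).measurable, Measure.ext fun s hs => ?_⟩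
  have hpre := (sphereHomeomorph g).measurable hs
  rw [Measure.map_apply (sphereHomeomorph g).measurable hs, Measure.toSphere_apply' _ hs,
    Measure.toSphere_apply' _ hpre]
  congr 1
  have e : Ioo (0 : ℝ) 1 • ((↑) '' (sphereHomeomorph g ⁻¹' s) : Set (EuclideanSpace ℝ (Fin N)))
      = g.toHomeomorph.toMeasurableEquiv ⁻¹'
        (Ioo (0 : ℝ) 1 • ((↑) '' s : Set (EuclideanSpace ℝ (Fin N)))) := by
    ext z
    simp only [Set.mem_smul, mem_image, mem_preimage]
    constructor
    · rintro ⟨t, ht, _, ⟨y, hy, rfl⟩, rfl⟩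
      exact ⟨t, ht, _, ⟨_, hy, rfl⟩, (map_smul g t (y : EuclideanSpace ℝ (Fin N))).symm⟩
    · rintro ⟨t, ht, _, ⟨y, hy, rfl⟩, h⟩
      refine ⟨t, ht, _, ⟨(sphereHomeomorph g).symm y, by simpa using hy, rfl⟩, ?_⟩
      change t • g.symm (y : EuclideanSpace ℝ (Fin N)) = z
      rw [← map_smul, h]
      exact g.symm_apply_apply z
  rw [e]
  exact (g.measurePreserving : MeasurePreserving g.toHomeomorph.toMeasurableEquiv volume
    volume).measure_preimage_equiv _

/-- The normalized surface measure on the unit sphere. -/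
noncomputable def sphereMeasure (N : ℕ) : Measure (sphere (0 : EuclideanSpace ℝ (Fin N)) 1) :=
  ((volume : Measure (EuclideanSpace ℝ (Fin N))).toSphere univ)⁻¹ •
    (volume : Measure (EuclideanSpace ℝ (Fin N))).toSphere

instance isProbabilityMeasure_sphereMeasure {N : ℕ} [NeZero N] :
    IsProbabilityMeasure (sphereMeasure N) := by
  have : NeZero (volume : Measure (EuclideanSpace ℝ (Fin N))).toSphere :=
    ⟨Measure.toSphere_ne_zero _⟩
  exact isProbabilityMeasureSMul

instance isOpenPosMeasure_sphereMeasure {N : ℕ} : (sphereMeasure N).IsOpenPosMeasure :=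
  Measure.isOpenPosMeasure_smul _ (ENNReal.inv_ne_zero.2 (measure_ne_top _ _))

theorem isometryInvariant_sphereMeasure (N : ℕ) : IsometryInvariant (sphereMeasure N) := by
  intro g f
  rw [sphereMeasure, integral_smul_measure, integral_smul_measure]
  congr 1
  exact (measurePreserving_sphereHomeomorph g).integral_comp
    (sphereHomeomorph g).measurableEmbedding fun y => f y

section Boundary

variable {N : ℕ} {σ : Measure (sphere (0 : EuclideanSpace ℝ (Fin N)) 1)}
  {v g : sphere (0 : EuclideanSpace ℝ (Fin N)) 1 → ℝ}

/-- `g` is the uniform radial derivative at the boundary of the Poisson integral of `v`. -/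
def HasPoissonRadialDeriv (σ : Measure (sphere (0 : EuclideanSpace ℝ (Fin N)) 1))
    (v g : sphere (0 : EuclideanSpace ℝ (Fin N)) 1 → ℝ) : Prop :=
  ∀ ε > 0, ∀ᶠ r in 𝓝[<] (1 : ℝ), ∀ x : sphere (0 : EuclideanSpace ℝ (Fin N)) 1,
    |poissonIntegral σ v (r • (x : EuclideanSpace ℝ (Fin N))) - v x + (1 - r) * g x| ≤ ε * (1 - r)

theorem eventually_mem_Ioo_nhdsLT_one : ∀ᶠ r in 𝓝[<] (1 : ℝ), r ∈ Ioo (0 : ℝ) 1 :=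
  Ioo_mem_nhdsLT zero_lt_one

theorem poissonIntegral_neg (x : EuclideanSpace ℝ (Fin N)) :
    poissonIntegral σ (fun y => -v y) x = -poissonIntegral σ v x := by
  simp only [poissonIntegral, mul_neg, integral_neg]

theorem HasPoissonRadialDeriv.neg (h : HasPoissonRadialDeriv σ v g) :
    HasPoissonRadialDeriv σ (fun x => -v x) (fun x => -g x) := by
  intro ε hε
  filter_upwards [h ε hε] with r hr x
  rw [poissonIntegral_neg, ← abs_neg]
  convert hr x using 2
  ring

theorem HasPoissonRadialDeriv.eventually_abs_integral_le [IsProbabilityMeasure σ]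
    (h : HasPoissonRadialDeriv σ v g) (hv : Continuous v) (hg : Continuous g)
    {f : sphere (0 : EuclideanSpace ℝ (Fin N)) 1 → ℝ} (hf : Continuous f) {ε : ℝ} (hε : 0 < ε) :
    ∀ᶠ r in 𝓝[<] (1 : ℝ),
      |∫ x, f x * poissonIntegral σ v (r • (x : EuclideanSpace ℝ (Fin N))) ∂σ - ∫ x, f x * v x ∂σ
        + (1 - r) * ∫ x, f x * g x ∂σ| ≤ ε * (1 - r) := by
  obtain ⟨M, hM⟩ := isCompact_univ.exists_bound_of_continuousOn hf.continuousOn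
  filter_upwards [h (ε / (|M| + 1)) (by positivity), eventually_mem_Ioo_nhdsLT_one] with r hr hr1
  have hP := continuous_poissonIntegral_smul (σ := σ) hv hr1.1.le hr1.2
  have i1 : Integrable (fun x : sphere (0 : EuclideanSpace ℝ (Fin N)) 1 =>
      f x * poissonIntegral σ v (r • (x : EuclideanSpace ℝ (Fin N)))) σ :=
    (hf.mul hP).integrable_of_compactSpace
  have i2 : Integrable (fun x => f x * v x) σ := (hf.mul hv).integrable_of_compactSpace
  have i3 : Integrable (fun x => (1 - r) * (f x * g x)) σ :=
    (continuous_const.mul (hf.mul hg)).integrable_of_compactSpace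
  have i4 : Integrable (fun x : sphere (0 : EuclideanSpace ℝ (Fin N)) 1 =>
      f x * poissonIntegral σ v (r • (x : EuclideanSpace ℝ (Fin N))) - f x * v x) σ := i1.sub i2
  rw [← integral_const_mul, ← integral_sub i1 i2, ← integral_add i4 i3, ← Real.norm_eq_abs]
  have hb : ∀ x : sphere (0 : EuclideanSpace ℝ (Fin N)) 1,
      ‖f x * poissonIntegral σ v (r • (x : EuclideanSpace ℝ (Fin N))) - f x * v x
        + (1 - r) * (f x * g x)‖ ≤ ε * (1 - r) := by
    intro x
    have e : f x * poissonIntegral σ v (r • (x : EuclideanSpace ℝ (Fin N))) - f x * v x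
        + (1 - r) * (f x * g x)
        = f x * (poissonIntegral σ v (r • (x : EuclideanSpace ℝ (Fin N))) - v x
          + (1 - r) * g x) := by ring
    have hfx : |f x| ≤ |M| + 1 := (hM x (mem_univ _)).trans (by linarith [le_abs_self M])
    rw [e, norm_mul, Real.norm_eq_abs, Real.norm_eq_abs]
    calc _ ≤ (|M| + 1) * (ε / (|M| + 1) * (1 - r)) :=
          mul_le_mul hfx (hr x) (abs_nonneg _) (by positivity)
      _ = _ := by field_simp
  have := norm_integral_le_of_norm_le_const (μ := σ) (Eventually.of_forall hb)
  rwa [probReal_univ, mul_one] at this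

theorem integral_poissonIntegral [IsProbabilityMeasure σ] (hN : 0 < N) (hσ : IsometryInvariant σ)
    (hv : Continuous v) {r : ℝ} (hr : 0 ≤ r) (hr1 : r < 1) :
    ∫ x, poissonIntegral σ v (r • (x : EuclideanSpace ℝ (Fin N))) ∂σ = ∫ x, v x ∂σ := by
  have h := integral_poissonIntegral_mul_comm (σ := σ) hv (g := fun _ => 1) continuous_const hr hr1
  simp only [one_mul] at h
  rw [h]
  refine integral_congr_ae (Eventually.of_forall fun x => ?_)
  dsimp only
  rw [poissonIntegral_one hN hσ ((norm_smul_coe_sphere x hr).trans_lt hr1), mul_one]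

theorem HasPoissonRadialDeriv.integral_eq_zero [IsProbabilityMeasure σ] (hN : 0 < N)
    (hσ : IsometryInvariant σ) (h : HasPoissonRadialDeriv σ v g) (hv : Continuous v)
    (hg : Continuous g) : ∫ x, g x ∂σ = 0 := by
  refine eq_of_abs_sub_le_all fun ε hε => ?_
  obtain ⟨r, h1, hr⟩ := ((h.eventually_abs_integral_le hv hg (f := fun _ => 1) continuous_const
    hε).and eventually_mem_Ioo_nhdsLT_one).exists
  have hpos : 0 < 1 - r := by linarith [hr.2]
  simp only [one_mul] at h1
  rw [integral_poissonIntegral hN hσ hv hr.1.le hr.2, sub_self, zero_add, abs_mul,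
    abs_of_pos hpos] at h1
  rw [sub_zero]
  nlinarith

/-- A function whose Poisson integral has itself as radial derivative is linear. -/
theorem HasPoissonRadialDeriv.exists_eq_inner [IsProbabilityMeasure σ] [σ.IsOpenPosMeasure]
    (hN : 0 < N) (hσ : IsometryInvariant σ) (h : HasPoissonRadialDeriv σ v v) (hv : Continuous v) :
    ∃ a : EuclideanSpace ℝ (Fin N), ∀ x : sphere (0 : EuclideanSpace ℝ (Fin N)) 1,
      v x = ⟪a, (x : EuclideanSpace ℝ (Fin N))⟫ := by
  have hmean := h.integral_eq_zero hN hσ hv hv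
  refine exists_eq_inner_of_poissonIntegral_smul_eq_mul hv hmean fun r hr hr1 =>
    poissonIntegral_smul_eq_mul hN hσ hv hmean (fun ε hε => ?_) hr hr1
  filter_upwards [h.eventually_abs_integral_le hv hv hv hε] with r hr
  simp only [← pow_two] at hr
  linarith [(abs_le.1 hr).1]

/-- A function vanishing on a nonempty open subset of the sphere is not a nonzero linear one. -/
theorem eq_zero_of_inner_eq_zero_on_open {O : Set (sphere (0 : EuclideanSpace ℝ (Fin N)) 1)}
    (hO : IsOpen O) (hne : O.Nonempty) {c : EuclideanSpace ℝ (Fin N)}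
    (hc : ∀ x ∈ O, ⟪c, (x : EuclideanSpace ℝ (Fin N))⟫ = 0) : c = 0 := by
  by_contra hc0
  obtain ⟨x, hx⟩ := hne
  have hcx : ⟪(x : EuclideanSpace ℝ (Fin N)), c⟫ = 0 := by rw [real_inner_comm]; exact hc x hx
  set e : EuclideanSpace ℝ (Fin N) := ‖c‖⁻¹ • c with he
  have hcn : 0 < ‖c‖ := norm_pos_iff.2 hc0
  have hen : ‖e‖ = 1 := by
    rw [he, norm_smul, norm_inv, norm_norm, inv_mul_cancel₀ hcn.ne']
  have hxe : ⟪(x : EuclideanSpace ℝ (Fin N)), e⟫ = 0 := by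
    rw [he, real_inner_smul_right, hcx, mul_zero]
  have hce : ⟪c, e⟫ = ‖c‖ := by
    rw [he, real_inner_smul_right, real_inner_self_eq_norm_sq]
    field_simp
  have hmem : ∀ t : ℝ, Real.cos t • (x : EuclideanSpace ℝ (Fin N)) + Real.sin t • e
      ∈ sphere (0 : EuclideanSpace ℝ (Fin N)) 1 := by
    intro t
    rw [mem_sphere_zero_iff_norm, ← sq_eq_sq₀ (norm_nonneg _) zero_le_one, norm_add_sq_real,
      norm_smul, norm_smul, real_inner_smul_left, real_inner_smul_right, hxe, hen,
      norm_coe_sphere, Real.norm_eq_abs, Real.norm_eq_abs, mul_one, mul_one, sq_abs, sq_abs]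
    linarith [Real.cos_sq_add_sin_sq t]
  have hγ : Continuous fun t : ℝ => (⟨_, hmem t⟩ : sphere (0 : EuclideanSpace ℝ (Fin N)) 1) := by
    fun_prop
  have h0 : (⟨_, hmem 0⟩ : sphere (0 : EuclideanSpace ℝ (Fin N)) 1) ∈ O := by simpa using hx
  have hev : ∀ᶠ t in 𝓝[>] (0 : ℝ), (⟨_, hmem t⟩ : sphere (0 : EuclideanSpace ℝ (Fin N)) 1) ∈ O :=
    nhdsWithin_le_nhds (hγ.continuousAt.eventually (hO.mem_nhds h0))
  obtain ⟨t, ht, ht1⟩ := (hev.and (Ioo_mem_nhdsGT Real.pi_pos)).exists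
  have h1 := hc _ ht
  rw [inner_add_right, real_inner_smul_right, real_inner_smul_right, hc x hx, hce, mul_zero,
    zero_add] at h1
  exact (mul_pos (Real.sin_pos_of_mem_Ioo ht1) hcn).ne' h1

end Boundary

section Sign

variable {N : ℕ} {σ : Measure (sphere (0 : EuclideanSpace ℝ (Fin N)) 1)}
  {v g : sphere (0 : EuclideanSpace ℝ (Fin N)) 1 → ℝ}

theorem integral_pos_of_continuous [IsProbabilityMeasure σ] [σ.IsOpenPosMeasure]
    {f : sphere (0 : EuclideanSpace ℝ (Fin N)) 1 → ℝ} (hf : Continuous f) (h0 : ∀ x, 0 ≤ f x)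
    {x : sphere (0 : EuclideanSpace ℝ (Fin N)) 1} (hx : f x ≠ 0) : 0 < ∫ x, f x ∂σ :=
  hf.integral_pos_of_hasCompactSupport_nonneg_nonzero (HasCompactSupport.of_compactSpace f) h0 hx

/-- If a nonnegative nonzero function agrees with the radial derivative of its Poisson integral
wherever it does not vanish, then it agrees with it everywhere. -/
theorem HasPoissonRadialDeriv.eq_of_nonneg [IsProbabilityMeasure σ] [σ.IsOpenPosMeasure]
    (hN : 2 ≤ N) (h : HasPoissonRadialDeriv σ v g) (hv : Continuous v) (hg : Continuous g)
    (hvg : ∀ x, v x ≠ 0 → g x = v x) (h0 : ∀ x, 0 ≤ v x)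
    {x₀ : sphere (0 : EuclideanSpace ℝ (Fin N)) 1} (hx₀ : v x₀ ≠ 0) : g = v := by
  have hO : IsOpen {x | g x ≠ v x} := isOpen_ne_fun hg hv
  have hOv : {x | g x ≠ v x} ⊆ {x | v x = 0} := fun x hx => by
    by_contra hvx
    exact hx (hvg x hvx)
  have hpos : 0 < ∫ x, v x ∂σ := integral_pos_of_continuous hv h0 hx₀
  have hclosed : IsClosed {x | g x ≠ v x} := by
    refine isClosed_of_closure_subset fun x hx hgx => ?_
    have hvx : v x = 0 := closure_minimal hOv (isClosed_eq hv continuous_const) hx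
    set κ : ℝ := 4 ^ (-(N : ℝ) / 2) * ∫ x, v x ∂σ with hκ
    have hκ0 : 0 < κ := by positivity
    obtain ⟨r, h1, hr⟩ := ((h (κ / 2) (by positivity)).and eventually_mem_Ioo_nhdsLT_one).exists
    have h2 := (abs_le.1 (h1 x)).2
    rw [show g x = 0 from hgx.trans hvx, hvx, mul_zero, add_zero, sub_zero] at h2
    have h3 : (1 - r) * κ ≤ poissonIntegral σ v (r • (x : EuclideanSpace ℝ (Fin N))) := by
      rw [hκ, ← mul_assoc, ← integral_const_mul]
      refine integral_mono (continuous_const.mul hv).integrable_of_compactSpace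
        (integrable_ballKernel_mul hv ((norm_smul_coe_sphere x hr.1.le).trans_lt hr.2)) fun y => ?_
      exact mul_le_mul_of_nonneg_right (ballKernel_smul_ge (norm_coe_sphere x) (norm_coe_sphere y)
        hr.1.le hr.2) (h0 y)
    nlinarith [hr.2]
  have : PreconnectedSpace (sphere (0 : EuclideanSpace ℝ (Fin N)) 1) := by
    refine Subtype.preconnectedSpace (isPreconnected_sphere ?_ 0 1)
    rw [← Module.finrank_eq_rank, finrank_euclideanSpace_fin]
    exact_mod_cast hN
  rcases isClopen_iff.1 ⟨hclosed, hO⟩ with h1 | h1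
  · funext x
    by_contra hx
    exact (h1 ▸ (show x ∈ {x | g x ≠ v x} from hx) : x ∈ (∅ : Set _))
  · exact absurd (hOv (h1 ▸ mem_univ x₀)) hx₀

/-- If a function taking both signs agrees with the radial derivative of its Poisson integral
wherever it does not vanish, then it agrees with it everywhere. -/
theorem HasPoissonRadialDeriv.eq_of_pos_of_neg [IsProbabilityMeasure σ] [σ.IsOpenPosMeasure]
    (hN : 0 < N) (hσ : IsometryInvariant σ) (h : HasPoissonRadialDeriv σ v g) (hv : Continuous v)
    (hg : Continuous g) (hvg : ∀ x, v x ≠ 0 → g x = v x)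
    {x₁ x₂ : sphere (0 : EuclideanSpace ℝ (Fin N)) 1} (hx₁ : 0 < v x₁) (hx₂ : v x₂ < 0) :
    g = v := by
  set p : sphere (0 : EuclideanSpace ℝ (Fin N)) 1 → ℝ := fun x => max (v x) 0 with hp
  set n : sphere (0 : EuclideanSpace ℝ (Fin N)) 1 → ℝ := fun x => max (-v x) 0 with hn
  have hpc : Continuous p := hv.max continuous_const
  have hnc : Continuous n := hv.neg.max continuous_const
  have hp0 : ∀ x, 0 ≤ p x := fun x => le_max_right _ _
  have hn0 : ∀ x, 0 ≤ n x := fun x => le_max_right _ _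
  have hpos : 0 < ∫ x, p x ∂σ :=
    integral_pos_of_continuous hpc hp0 (lt_max_of_lt_left hx₁).ne'
  have hneg : 0 < ∫ x, n x ∂σ :=
    integral_pos_of_continuous hnc hn0 (lt_max_of_lt_left (neg_pos.2 hx₂)).ne'
  set a := ∫ x, n x ∂σ with ha
  set b := ∫ x, p x ∂σ with hb
  have hcases : ∀ x, (0 < v x ∧ p x = v x ∧ n x = 0) ∨ (v x < 0 ∧ p x = 0 ∧ n x = -v x) ∨
      (v x = 0 ∧ p x = 0 ∧ n x = 0) := by
    intro x
    rcases lt_trichotomy (v x) 0 with hx | hx | hx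
    · exact Or.inr (Or.inl ⟨hx, max_eq_right hx.le, max_eq_left (by linarith)⟩)
    · exact Or.inr (Or.inr ⟨hx, by simp [hp, hx], by simp [hn, hx]⟩)
    · exact Or.inl ⟨hx, max_eq_left hx.le, max_eq_right (by linarith)⟩
  have hpv : ∀ x, p x * v x = p x ^ 2 := fun x => by
    rcases hcases x with ⟨-, h1, -⟩ | ⟨-, h1, -⟩ | ⟨-, h1, -⟩ <;> rw [h1] <;> ring
  have hnv : ∀ x, n x * v x = -n x ^ 2 := fun x => by
    rcases hcases x with ⟨-, -, h1⟩ | ⟨-, -, h1⟩ | ⟨-, -, h1⟩ <;> rw [h1] <;> ring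
  have hpn : ∀ x, p x * n x = 0 := fun x => by
    rcases hcases x with ⟨-, h1, h2⟩ | ⟨-, h1, h2⟩ | ⟨-, h1, h2⟩ <;> rw [h1, h2] <;> ring
  have hpg : ∀ x, p x * g x = p x ^ 2 := fun x => by
    rcases hcases x with ⟨h0, h1, -⟩ | ⟨-, h1, -⟩ | ⟨-, h1, -⟩
    · rw [hvg x h0.ne', hpv]
    all_goals rw [h1]; ring
  have hng : ∀ x, n x * g x = -n x ^ 2 := fun x => by
    rcases hcases x with ⟨-, -, h1⟩ | ⟨h0, -, h1⟩ | ⟨-, -, h1⟩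
    · rw [h1]; ring
    · rw [hvg x h0.ne, hnv]
    · rw [h1]; ring
  set w : sphere (0 : EuclideanSpace ℝ (Fin N)) 1 → ℝ := fun x => a * p x - b * n x with hw
  have hwc : Continuous w := (continuous_const.mul hpc).sub (continuous_const.mul hnc)
  have i1 : Integrable (fun x => a * p x) σ :=
    (continuous_const.mul hpc).integrable_of_compactSpace
  have i2 : Integrable (fun x => b * n x) σ :=
    (continuous_const.mul hnc).integrable_of_compactSpace
  have i3 : Integrable (fun x => a ^ 2 * p x ^ 2) σ :=
    (continuous_const.mul (hpc.pow 2)).integrable_of_compactSpace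
  have i4 : Integrable (fun x => b ^ 2 * n x ^ 2) σ :=
    (continuous_const.mul (hnc.pow 2)).integrable_of_compactSpace
  have hmean : ∫ x, w x ∂σ = 0 := by
    have h1 := integral_sub (μ := σ) i1 i2
    rw [integral_const_mul, integral_const_mul] at h1
    exact h1.trans (by ring)
  have hwsq : ∫ x, w x ^ 2 ∂σ = a ^ 2 * ∫ x, p x ^ 2 ∂σ + b ^ 2 * ∫ x, n x ^ 2 ∂σ := by
    rw [← integral_const_mul, ← integral_const_mul, ← integral_add i3 i4]
    refine integral_congr_ae (Eventually.of_forall fun x => ?_)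
    linear_combination (-2 * a * b) * hpn x
  have hray : ∀ ε > 0, ∀ᶠ r in 𝓝[<] (1 : ℝ), r * ∫ x, w x ^ 2 ∂σ - ε * (1 - r)
      ≤ ∫ x, w x * poissonIntegral σ w (r • (x : EuclideanSpace ℝ (Fin N))) ∂σ := by
    intro ε hε
    have hη : 0 < ε / (a ^ 2 + b ^ 2) := by positivity
    filter_upwards [h.eventually_abs_integral_le hv hg hpc hη,
      h.eventually_abs_integral_le hv hg hnc hη, eventually_mem_Ioo_nhdsLT_one] with r h1 h2 hr
    simp only [hpv, hpg] at h1
    simp only [hnv, hng, integral_neg] at h2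
    have hx1 : ∀ x : sphere (0 : EuclideanSpace ℝ (Fin N)) 1,
        ‖r • (x : EuclideanSpace ℝ (Fin N))‖ < 1 := fun x =>
      (norm_smul_coe_sphere x hr.1.le).trans_lt hr.2
    have hcomb : ∀ (α β : ℝ) (x : sphere (0 : EuclideanSpace ℝ (Fin N)) 1),
        poissonIntegral σ (fun y => α * p y - β * n y) (r • (x : EuclideanSpace ℝ (Fin N)))
        = α * poissonIntegral σ p (r • (x : EuclideanSpace ℝ (Fin N)))
          - β * poissonIntegral σ n (r • (x : EuclideanSpace ℝ (Fin N))) := by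
      intro α β x
      simp only [poissonIntegral]
      rw [← integral_const_mul, ← integral_const_mul, ← integral_sub
        ((integrable_ballKernel_mul hpc (hx1 x)).const_mul α)
        ((integrable_ballKernel_mul hnc (hx1 x)).const_mul β)]
      exact integral_congr_ae (Eventually.of_forall fun y => by ring)
    have hP : ∀ {f : sphere (0 : EuclideanSpace ℝ (Fin N)) 1 → ℝ}, Continuous f →
        Continuous fun x : sphere (0 : EuclideanSpace ℝ (Fin N)) 1 =>
          poissonIntegral σ f (r • (x : EuclideanSpace ℝ (Fin N))) :=
      fun hf => continuous_poissonIntegral_smul hf hr.1.le hr.2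
    have hintegrable : ∀ {f k : sphere (0 : EuclideanSpace ℝ (Fin N)) 1 → ℝ}, Continuous f →
        Continuous k → Integrable (fun x : sphere (0 : EuclideanSpace ℝ (Fin N)) 1 =>
          f x * poissonIntegral σ k (r • (x : EuclideanSpace ℝ (Fin N)))) σ :=
      fun hf hk => (hf.mul (hP hk)).integrable_of_compactSpace
    set B : (sphere (0 : EuclideanSpace ℝ (Fin N)) 1 → ℝ) →
      (sphere (0 : EuclideanSpace ℝ (Fin N)) 1 → ℝ) → ℝ := fun f k =>
        ∫ x, f x * poissonIntegral σ k (r • (x : EuclideanSpace ℝ (Fin N))) ∂σ with hB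
    have hlin : ∀ {f : sphere (0 : EuclideanSpace ℝ (Fin N)) 1 → ℝ}, Continuous f → ∀ α β : ℝ,
        B f (fun y => α * p y - β * n y) = α * B f p - β * B f n := by
      intro f hf α β
      simp only [hB, hcomb]
      rw [← integral_const_mul, ← integral_const_mul,
        ← integral_sub ((hintegrable hf hpc).const_mul α) ((hintegrable hf hnc).const_mul β)]
      exact integral_congr_ae (Eventually.of_forall fun y => by ring)
    have hsymm : ∀ {f k : sphere (0 : EuclideanSpace ℝ (Fin N)) 1 → ℝ}, Continuous f →
        Continuous k → B f k = B k f := fun hf hk =>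
      integral_poissonIntegral_mul_comm hk hf hr.1.le hr.2
    have hvB : ∀ {f : sphere (0 : EuclideanSpace ℝ (Fin N)) 1 → ℝ}, Continuous f →
        B f v = B f p - B f n := by
      intro f hf
      have h3 := hlin hf 1 1
      have e : (fun y => 1 * p y - 1 * n y) = v := by
        funext y
        rcases hcases y with ⟨-, h1, h2⟩ | ⟨-, h1, h2⟩ | ⟨h0, h1, h2⟩ <;> rw [h1, h2] <;> linarith
      rw [e] at h3
      linarith
    have hww : B w w = a ^ 2 * B p v - b ^ 2 * B n v + (a - b) ^ 2 * B n p := by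
      have e1 := hlin hwc a b
      have e2 := hlin hpc a b
      have e3 := hlin hnc a b
      rw [hsymm hwc hpc, hsymm hwc hnc] at e1
      have e4 := hsymm hpc hnc
      rw [hvB hpc, hvB hnc]
      have e1' : B w w = a * B p w - b * B n w := e1
      have e2' : B p w = a * B p p - b * B p n := e2
      have e3' : B n w = a * B n p - b * B n n := e3
      rw [e1', e2', e3', e4]
      ring
    have hnp : 0 ≤ B n p := integral_nonneg fun x => mul_nonneg (hn0 x)
      (integral_nonneg fun y => mul_nonneg (ballKernel_nonneg (hx1 x) _) (hp0 y))
    have h3 : r * ∫ x, p x ^ 2 ∂σ - ε / (a ^ 2 + b ^ 2) * (1 - r) ≤ B p v := by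
      linarith [(abs_le.1 h1).1]
    have h4 : B n v ≤ -(r * ∫ x, n x ^ 2 ∂σ) + ε / (a ^ 2 + b ^ 2) * (1 - r) := by
      linarith [(abs_le.1 h2).2]
    have h5 : ε / (a ^ 2 + b ^ 2) * (a ^ 2 + b ^ 2) = ε := div_mul_cancel₀ _ (by positivity)
    change _ ≤ B w w
    rw [hww, hwsq]
    have h6 := mul_le_mul_of_nonneg_left h3 (sq_nonneg a)
    have h7 := mul_le_mul_of_nonneg_left h4 (sq_nonneg b)
    have h8 : 0 ≤ (a - b) ^ 2 * B n p := by positivity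
    linear_combination h6 + h7 + h8 + (1 - r) * h5
  obtain ⟨c, hc⟩ := exists_eq_inner_of_poissonIntegral_smul_eq_mul hwc hmean fun r hr hr1 =>
    poissonIntegral_smul_eq_mul hN hσ hwc hmean hray hr hr1
  by_contra hne
  have hc0 : c = 0 := by
    refine eq_zero_of_inner_eq_zero_on_open (isOpen_ne_fun hg hv) ?_ fun x hx => ?_
    · obtain ⟨x, hx⟩ := Function.ne_iff.1 hne
      exact ⟨x, hx⟩
    · have hvx : v x = 0 := by
        by_contra hvx
        exact hx (hvg x hvx)
      rw [← hc x]
      simp [hw, hp, hn, hvx]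
  have h1 := hc x₁
  rw [hc0, inner_zero_left] at h1
  have h2 : w x₁ = a * v x₁ := by
    simp only [hw, hp, hn]
    rw [max_eq_left hx₁.le, max_eq_right (by linarith), mul_zero, sub_zero]
  exact (mul_pos hneg hx₁).ne' (h2.symm.trans h1)

/-- A function that agrees with the radial derivative of its Poisson integral wherever it does not
vanish is linear. -/
theorem HasPoissonRadialDeriv.exists_eq_inner_of_ne_zero [IsProbabilityMeasure σ]
    [σ.IsOpenPosMeasure] (hN : 2 ≤ N) (hσ : IsometryInvariant σ)
    (h : HasPoissonRadialDeriv σ v g) (hv : Continuous v) (hg : Continuous g)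
    (hvg : ∀ x, v x ≠ 0 → g x = v x) :
    ∃ a : EuclideanSpace ℝ (Fin N), ∀ x : sphere (0 : EuclideanSpace ℝ (Fin N)) 1,
      v x = ⟪a, (x : EuclideanSpace ℝ (Fin N))⟫ := by
  by_cases hv0 : ∀ x, v x = 0
  · exact ⟨0, fun x => by rw [hv0 x, inner_zero_left]⟩
  push Not at hv0
  obtain ⟨x₀, hx₀⟩ := hv0
  suffices hgv : g = v by
    subst hgv
    exact h.exists_eq_inner (by omega) hσ hv
  by_cases hp : ∀ x, 0 ≤ v x
  · exact h.eq_of_nonneg hN hv hg hvg hp hx₀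
  push Not at hp
  obtain ⟨x₂, hx₂⟩ := hp
  by_cases hn : ∀ x, v x ≤ 0
  · have h1 := h.neg.eq_of_nonneg hN hv.neg hg.neg
      (fun x hx => by rw [hvg x (neg_ne_zero.1 hx)]) (fun x => neg_nonneg.2 (hn x))
      (neg_ne_zero.2 hx₀)
    funext x
    exact neg_injective (congrFun h1 x)
  · push Not at hn
    obtain ⟨x₁, hx₁⟩ := hn
    exact h.eq_of_pos_of_neg (by omega) hσ hv hg hvg hx₁ hx₂

end Sign

section Steklov

variable {N : ℕ} {ψ : EuclideanSpace ℝ (Fin N) → ℝ}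

theorem uniqueDiffOn_unit_closedBall :
    UniqueDiffOn ℝ (closedBall (0 : EuclideanSpace ℝ (Fin N)) 1) := by
  refine uniqueDiffOn_convex (convex_closedBall 0 1) ⟨0, ?_⟩
  exact mem_interior_iff_mem_nhds.2 (closedBall_mem_nhds 0 one_pos)

/-- First order expansion of a `C¹` function at the boundary along radii. -/
theorem eventually_abs_sub_add_fderivWithin_le (hC1 : ContDiffOn ℝ 1 ψ (closedBall 0 1)) {ε : ℝ}
    (hε : 0 < ε) : ∀ᶠ r in 𝓝[<] (1 : ℝ), ∀ x : EuclideanSpace ℝ (Fin N), ‖x‖ = 1 →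
      |ψ (r • x) - ψ x + (1 - r) * fderivWithin ℝ ψ (closedBall 0 1) x x| ≤ ε * (1 - r) := by
  have hDc := hC1.continuousOn_fderivWithin uniqueDiffOn_unit_closedBall le_rfl
  obtain ⟨δ, hδ, hδD⟩ := Metric.uniformContinuousOn_iff.1
    ((isCompact_closedBall (0 : EuclideanSpace ℝ (Fin N)) 1).uniformContinuousOn_of_continuous hDc)
    ε hε
  have hltδ : ∀ᶠ r in 𝓝[<] (1 : ℝ), 1 - δ < r := nhdsWithin_le_nhds (lt_mem_nhds (by linarith))
  filter_upwards [hltδ, eventually_mem_Ioo_nhdsLT_one] with r hrδ hr x hx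
  have hball : ∀ t ∈ Icc r 1, t • x ∈ closedBall (0 : EuclideanSpace ℝ (Fin N)) 1 := by
    intro t ht
    rw [mem_closedBall_zero_iff, norm_smul, hx, mul_one,
      Real.norm_of_nonneg (hr.1.le.trans ht.1)]
    exact ht.2
  have hderiv : ∀ t ∈ Icc r 1, HasDerivWithinAt
      (fun t : ℝ => ψ (t • x) - t * fderivWithin ℝ ψ (closedBall 0 1) x x)
      (fderivWithin ℝ ψ (closedBall 0 1) (t • x) x - fderivWithin ℝ ψ (closedBall 0 1) x x)
      (Icc r 1) t := by
    intro t ht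
    have h1 : HasDerivWithinAt (fun t : ℝ => t • x) x (Icc r 1) t := by
      simpa using ((hasDerivAt_id t).smul_const x).hasDerivWithinAt
    have h2 := ((hC1.differentiableOn one_ne_zero) (t • x) (hball t ht)).hasFDerivWithinAt
    have h3 := h2.comp_hasDerivWithinAt t h1 fun s hs => hball s hs
    have h4 := ((hasDerivAt_id t).mul_const
      (fderivWithin ℝ ψ (closedBall 0 1) x x)).hasDerivWithinAt (s := Icc r 1)
    exact (h3.sub h4).congr_deriv (by rw [one_mul])
  have hbound : ∀ t ∈ Icc r 1,
      ‖fderivWithin ℝ ψ (closedBall 0 1) (t • x) x - fderivWithin ℝ ψ (closedBall 0 1) x x‖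
        ≤ ε := by
    intro t ht
    have hd : dist (t • x) x < δ := by
      have e : t • x - x = -((1 - t) • x) := by rw [sub_smul, one_smul, neg_sub]
      rw [dist_eq_norm, e, norm_neg, norm_smul, hx, mul_one,
        Real.norm_of_nonneg (by linarith [ht.2])]
      linarith [ht.1]
    have h1 := (hδD _ (hball t ht) x (by simp [hx]) hd).le
    rw [dist_eq_norm] at h1
    rw [← sub_apply]
    simpa [hx] using (ContinuousLinearMap.le_of_opNorm_le _ h1 x)
  have := (convex_Icc r 1).norm_image_sub_le_of_norm_hasDerivWithin_le hderiv hbound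
    (right_mem_Icc.2 hr.2.le) (left_mem_Icc.2 hr.2.le)
  rw [Real.norm_eq_abs, Real.norm_eq_abs, abs_sub_comm r 1,
    abs_of_pos (show (0 : ℝ) < 1 - r by linarith [hr.2]), one_smul] at this
  convert this using 2
  ring

theorem fderivWithin_eq_of_inner_gradient_eq {x : EuclideanSpace ℝ (Fin N)} (hx : ‖x‖ = 1)
    (h : ⟪gradient ψ x, x⟫ = ψ x) (hψ : ψ x ≠ 0) :
    fderivWithin ℝ ψ (closedBall 0 1) x x = ψ x := by
  by_cases hd : DifferentiableAt ℝ ψ x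
  · rw [hd.fderivWithin (uniqueDiffOn_unit_closedBall x (by simp [hx])), ← h, gradient,
      InnerProductSpace.toDual_symm_apply]
  · rw [gradient, fderiv_zero_of_not_differentiableAt hd, map_zero, inner_zero_left] at h
    exact absurd h.symm hψ

theorem diffHarmonicOn_inner (a : EuclideanSpace ℝ (Fin N)) (s : Set (EuclideanSpace ℝ (Fin N))) :
    DiffHarmonicOn (fun x => ⟪a, x⟫) s := by
  intro x hx ε hε
  refine Eventually.of_forall fun h => ?_
  have : secondDiff (fun x => ⟪a, x⟫) x h = 0 := Finset.sum_eq_zero fun i _ => by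
    beta_reduce
    rw [inner_add_right, inner_sub_right]
    ring
  rw [this, abs_zero]
  positivity

end Steklov

end BallPoissonIntegral

/-- A harmonic function on the unit ball whose outward normal derivative on the
unit sphere equals its boundary value (a Steklov eigenfunction with eigenvalue 1)
is linear: `ψ(x) = ⟨a, x⟩` for some vector `a`. -/
theorem steklov_eigenvalue_one_linear (N : ℕ) (hN : 2 ≤ N)
    (ψ : EuclideanSpace ℝ (Fin N) → ℝ)
    (hC1 : ContDiffOn ℝ 1 ψ (Metric.closedBall 0 1))
    (hC2 : ContDiffOn ℝ 2 ψ (Metric.ball 0 1))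
    (hharm : ∀ x ∈ Metric.ball (0 : EuclideanSpace ℝ (Fin N)) 1, laplacian ψ x = 0)
    (hsteklov : ∀ x : EuclideanSpace ℝ (Fin N), ‖x‖ = 1 →
      ⟪gradient ψ x, x⟫ = ψ x) :
    ∃ a : EuclideanSpace ℝ (Fin N),
      ∀ x ∈ Metric.closedBall (0 : EuclideanSpace ℝ (Fin N)) 1, ψ x = ⟪a, x⟫ := by
  have hN0 : 0 < N := by omega
  have : NeZero N := ⟨hN0.ne'⟩
  have hψ := diffHarmonicOn_of_laplacian_eq_zero Metric.isOpen_ball hC2 hharm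
  have hmem : ∀ x : Metric.sphere (0 : EuclideanSpace ℝ (Fin N)) 1,
      (x : EuclideanSpace ℝ (Fin N)) ∈ Metric.closedBall 0 1 := fun x =>
    Metric.sphere_subset_closedBall x.2
  have hv : Continuous fun x : Metric.sphere (0 : EuclideanSpace ℝ (Fin N)) 1 =>
      ψ (x : EuclideanSpace ℝ (Fin N)) :=
    hC1.continuousOn.comp_continuous continuous_subtype_val hmem
  have hg : Continuous fun x : Metric.sphere (0 : EuclideanSpace ℝ (Fin N)) 1 =>
      fderivWithin ℝ ψ (Metric.closedBall 0 1) (x : EuclideanSpace ℝ (Fin N)) x :=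
    ((hC1.continuousOn_fderivWithin uniqueDiffOn_unit_closedBall le_rfl).comp_continuous
      continuous_subtype_val hmem).clm_apply continuous_subtype_val
  have hrad : HasPoissonRadialDeriv (sphereMeasure N) (fun x => ψ x)
      (fun x => fderivWithin ℝ ψ (Metric.closedBall 0 1) (x : EuclideanSpace ℝ (Fin N)) x) := by
    intro ε hε
    filter_upwards [eventually_abs_sub_add_fderivWithin_le hC1 hε, eventually_mem_Ioo_nhdsLT_one]
      with r h1 hr x
    rw [poissonIntegral_eq hN0 (isometryInvariant_sphereMeasure N) hψ hC1.continuousOn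
      ((norm_smul_coe_sphere x hr.1.le).trans_lt hr.2)]
    exact h1 x (norm_coe_sphere x)
  obtain ⟨a, ha⟩ := hrad.exists_eq_inner_of_ne_zero hN (isometryInvariant_sphereMeasure N) hv hg
    fun x hx => fderivWithin_eq_of_inner_gradient_eq (norm_coe_sphere x)
      (hsteklov x (norm_coe_sphere x)) hx
  refine ⟨a, fun x hx => ?_⟩
  have h0 := DiffHarmonicOn.abs_sub_le hN0 (ε := 0) hψ (diffHarmonicOn_inner a _)
    hC1.continuousOn (by fun_prop)
    (fun z hz => by rw [ha ⟨z, by simpa using hz⟩, sub_self, abs_zero])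
    (mem_closedBall_zero_iff.1 hx)
  exact sub_eq_zero.1 (abs_nonpos_iff.1 h0)
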